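/- Let (X_i)_{i≥0} be a stationary ergodic Markov chain with invariant measure μ and transition kernel K. Assume f ∈ C(M,p,μ) for some M > 0 and p ∈ (2,∞], and that Σ_{k>0} (α_1(k))^{(p−2)/p} < ∞. Then there exist measurable functions g : ℝ → ℝ with μ(|g|^{p/(p−1)}) < ∞ and m : ℝ × ℝ → ℝ such that almost surely f(X_1) − μ(f) = m(X_1,X_0) + g(X_0) − g(X_1), E(m(X_1,X_0) | X_0) = 0 almost surely, and E(m^2(X_1,X_0)) = σ^2(μ,K,f). -/

import Mathlib

open MeasureTheory ProbabilityTheory Filter Set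
open scoped ENNReal NNReal Topology

noncomputable section

/-- The intermittent (Liverani–Saussol–Vaienti) map `T_γ` on `[0,1]`. -/
def Tmap (γ : ℝ) (x : ℝ) : ℝ :=
  if x < 1/2 then x * (1 + 2 ^ γ * x ^ γ) else 2 * x - 1

/-- `K` is the Perron–Frobenius operator of `T_γ` with respect to `ν`:
`ν(f · g∘T_γ) = ν(K f · g)` for all bounded measurable `f, g`. -/
def IsPFOp (γ : ℝ) (ν : Measure ℝ) (K : (ℝ → ℝ) → ℝ → ℝ) : Prop :=
  ∀ f g : ℝ → ℝ, Measurable f → Measurable g → (∃ C, ∀ x, |f x| ≤ C) →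
    (∃ C, ∀ x, |g x| ≤ C) →
    ∫ x, f x * g (Tmap γ x) ∂ν = ∫ x, (K f) x * g x ∂ν

/-- Birkhoff sums `S_n(f) = ∑_{i=1}^n f ∘ T_γ^i`. -/
def Sn (γ : ℝ) (f : ℝ → ℝ) (n : ℕ) (x : ℝ) : ℝ :=
  ∑ i ∈ Finset.range n, f ((Tmap γ)^[i + 1] x)

/-- The class `H_{α,1}` of `α`-Hölder functions (with constant 1) on `[0,1]`. -/
def Hclass (α : ℝ) : Set (ℝ → ℝ) :=
  {f | ∀ x ∈ Set.Icc (0:ℝ) 1, ∀ y ∈ Set.Icc (0:ℝ) 1, |f x - f y| ≤ |x - y| ^ α}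

/-- `f_t = 1_{(-∞, t]}`. -/
def indic (t : ℝ) : ℝ → ℝ := Set.indicator (Set.Iic t) (fun _ => 1)

/-- Nested operator `K^{(n_1,…,n_k)}(f_1,…,f_k)
= K^{n_1}(f_1 · K^{n_2}(f_2 ⋯ K^{n_k}(f_k)⋯))`, encoded by a list of pairs. -/
def nestedK (K : (ℝ → ℝ) → ℝ → ℝ) : List (ℕ × (ℝ → ℝ)) → ℝ → ℝ
  | [] => fun _ => 1
  | (n, f) :: r => K^[n] (fun x => f x * nestedK K r x)

/-- The list `[(n, f_{t_1}), (n_2, f_{t_2}), …, (n_l, f_{t_l})]`. -/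
def tList (n : ℕ) {l : ℕ} (ns : Fin l → ℕ) (ts : Fin (l + 1) → ℝ) :
    List (ℕ × (ℝ → ℝ)) :=
  (n, indic (ts 0)) :: List.ofFn (fun i : Fin l => (ns i, indic (ts i.succ)))

/-- The coefficient `α_1(n)` for an operator `K` with invariant measure `ν`. -/
def alpha1 (K : (ℝ → ℝ) → ℝ → ℝ) (ν : Measure ℝ) (n : ℕ) : ℝ :=
  ⨆ t : ℝ, ∫ x, |K^[n] (indic t) x - ∫ y, indic t y ∂ν| ∂ν

/-- The dependence coefficient `α_k(n)`. -/
def alphaCoef (K : (ℝ → ℝ) → ℝ → ℝ) (ν : Measure ℝ) (k n : ℕ) : ℝ :=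
  max (alpha1 K ν n)
    (⨆ j : Fin (k - 1), ⨆ ns : {m : Fin (j.1 + 1) → ℕ // ∀ i, 1 ≤ m i},
      ⨆ ts : Fin (j.1 + 2) → ℝ,
        ∫ x, |nestedK K (tList n ns.1 ts) x - ∫ y, nestedK K (tList n ns.1 ts) y ∂ν| ∂ν)

/-- The dependence coefficient `β_1(n)`. -/
def beta1 (K : (ℝ → ℝ) → ℝ → ℝ) (ν : Measure ℝ) (n : ℕ) : ℝ :=
  ∫ x, (⨆ t : ℝ, |K^[n] (indic t) x - ∫ y, indic t y ∂ν|) ∂ν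

/-- The dependence coefficient `β_k(n)`. -/
def betaCoef (K : (ℝ → ℝ) → ℝ → ℝ) (ν : Measure ℝ) (k n : ℕ) : ℝ :=
  max (beta1 K ν n)
    (⨆ j : Fin (k - 1), ⨆ ns : {m : Fin (j.1 + 1) → ℕ // ∀ i, 1 ≤ m i},
      ∫ x, (⨆ ts : Fin (j.1 + 2) → ℝ,
        |nestedK K (tList n ns.1 ts) x - ∫ y, nestedK K (tList n ns.1 ts) y ∂ν|) ∂ν)

/-- The operator associated with a Markov transition kernel: `(Kg)(x) = ∫ g(y) K(x,dy)`. -/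
def Kop (K : Kernel ℝ ℝ) (g : ℝ → ℝ) : ℝ → ℝ := fun x => ∫ y, g y ∂(K x)

/-- The class `Mon(M,p,μ)` of monotonic functions on an open interval, vanishing
elsewhere, with tail condition `μ(|g|>t) ≤ M^p t^{-p}` (for `p < ∞`),
resp. `μ(|g|>M) = 0` (for `p = ∞`). -/
def Mon (M : ℝ) (p : ℝ≥0∞) (μ : Measure ℝ) (g : ℝ → ℝ) : Prop :=
  (∃ I : Set ℝ, IsOpen I ∧ I.OrdConnected ∧ (MonotoneOn g I ∨ AntitoneOn g I) ∧
      ∀ x ∉ I, g x = 0) ∧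
  (if p = ∞ then μ {x | M < |g x|} = 0
   else ∀ t : ℝ, 0 < t →
      μ {x | t < |g x|} ≤ ENNReal.ofReal (M ^ p.toReal * t ^ (-p.toReal)))

/-- The class `C(M,p,μ)`: the closure in `L¹(μ)` of convex-type combinations
`∑ a_i g_i`, `∑ |a_i| ≤ 1`, `g_i ∈ Mon(M,p,μ)`. -/
def ClassC (M : ℝ) (p : ℝ≥0∞) (μ : Measure ℝ) (f : ℝ → ℝ) : Prop :=
  Integrable f μ ∧ ∀ ε : ℝ, 0 < ε → ∃ (n : ℕ) (a : Fin n → ℝ) (g : Fin n → ℝ → ℝ),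
    (∑ i, |a i|) ≤ 1 ∧ (∀ i, Mon M p μ (g i)) ∧
    ∫ x, |f x - ∑ i, a i * g i x| ∂μ < ε

/-- The class `Lip_c` of functions `g` with `|g(x) − g(y)| ≤ c(|x−y|)`. -/
def LipC (c : ℝ → ℝ) : Set (ℝ → ℝ) := {g | ∀ x y : ℝ, |g x - g y| ≤ c |x - y|}

/-- The distance `d_c(P,Q) = sup_{g ∈ Lip_c} |P(g) − Q(g)|`. -/
def dC (c : ℝ → ℝ) (P Q : Measure ℝ) : ℝ :=
  ⨆ g : LipC c, |(∫ x, (g : ℝ → ℝ) x ∂P) - ∫ x, (g : ℝ → ℝ) x ∂Q|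

section InvariantKernel

set_option linter.unusedSectionVars false

variable {μ : Measure ℝ} [IsProbabilityMeasure μ] {κ : Kernel ℝ ℝ} [IsMarkovKernel κ]

lemma ae_ae_of_invariant (hκ : κ.Invariant μ) {s : ℝ → Prop} (h : ∀ᵐ y ∂μ, s y) :
    ∀ᵐ x ∂μ, ∀ᵐ y ∂(κ x), s y :=
  Measure.ae_ae_of_ae_comp (κ := κ) (μ := μ) (by rwa [hκ.def])

lemma Kop_congr_ae (hκ : κ.Invariant μ) {u v : ℝ → ℝ} (h : u =ᵐ[μ] v) :
    Kop κ u =ᵐ[μ] Kop κ v := by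
  filter_upwards [ae_ae_of_invariant hκ h] with x hx
  exact integral_congr_ae hx

lemma ae_integrable_of_invariant (hκ : κ.Invariant μ) {u : ℝ → ℝ} (hu : Integrable u μ) :
    ∀ᵐ x ∂μ, Integrable u (κ x) :=
  Measure.ae_integrable_of_integrable_comp (κ := κ) (μ := μ) (by rwa [hκ.def])

lemma measurable_Kop (κ : Kernel ℝ ℝ) [IsMarkovKernel κ] {u : ℝ → ℝ} (hu : Measurable u) :
    Measurable (Kop κ u) :=
  hu.stronglyMeasurable.integral_kernel.measurable

lemma aestronglyMeasurable_Kop (hκ : κ.Invariant μ) {u : ℝ → ℝ}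
    (hu : AEStronglyMeasurable u μ) : AEStronglyMeasurable (Kop κ u) μ :=
  ((measurable_Kop κ hu.stronglyMeasurable_mk.measurable).aestronglyMeasurable).congr
    (Kop_congr_ae hκ hu.ae_eq_mk.symm)

lemma eLpNorm_Kop_le (hκ : κ.Invariant μ) {r : ℝ≥0∞} (hr : 1 ≤ r) (hr' : r ≠ ∞) {u : ℝ → ℝ}
    (hu : AEStronglyMeasurable u μ) : eLpNorm (Kop κ u) r μ ≤ eLpNorm u r μ := by
  wlog hm : Measurable u generalizing u
  · have := this hu.stronglyMeasurable_mk.measurable.aestronglyMeasurable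
      hu.stronglyMeasurable_mk.measurable
    rwa [eLpNorm_congr_ae (Kop_congr_ae hκ hu.ae_eq_mk), eLpNorm_congr_ae hu.ae_eq_mk]
  have h0 : r ≠ 0 := (zero_lt_one.trans_le hr).ne'
  have hpos : 0 < r.toReal := ENNReal.toReal_pos h0 hr'
  rw [eLpNorm_eq_lintegral_rpow_enorm_toReal h0 hr', eLpNorm_eq_lintegral_rpow_enorm_toReal h0 hr']
  refine ENNReal.rpow_le_rpow ?_ (by positivity)
  have key : ∀ x, ‖Kop κ u x‖ₑ ^ r.toReal ≤ ∫⁻ y, ‖u y‖ₑ ^ r.toReal ∂(κ x) := by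
    intro x
    have h1 : ‖Kop κ u x‖ₑ ≤ eLpNorm u r (κ x) :=
      (enorm_integral_le_lintegral_enorm u).trans <| by
        rw [← eLpNorm_one_eq_lintegral_enorm]
        exact eLpNorm_le_eLpNorm_of_exponent_le hr hm.aestronglyMeasurable
    calc ‖Kop κ u x‖ₑ ^ r.toReal ≤ eLpNorm u r (κ x) ^ r.toReal := by gcongr
      _ = _ := by
        rw [eLpNorm_eq_lintegral_rpow_enorm_toReal h0 hr', ← ENNReal.rpow_mul,
          one_div_mul_cancel hpos.ne', ENNReal.rpow_one]
  calc ∫⁻ x, ‖Kop κ u x‖ₑ ^ r.toReal ∂μ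
      ≤ ∫⁻ x, ∫⁻ y, ‖u y‖ₑ ^ r.toReal ∂(κ x) ∂μ := lintegral_mono key
    _ = ∫⁻ y, ‖u y‖ₑ ^ r.toReal ∂(μ.bind κ) :=
        (Measure.lintegral_bind κ.aemeasurable (hm.enorm.pow_const _).aemeasurable).symm
    _ = _ := by rw [hκ.def]

lemma memLp_Kop (hκ : κ.Invariant μ) {r : ℝ≥0∞} (hr : 1 ≤ r) (hr' : r ≠ ∞) {u : ℝ → ℝ}
    (hu : MemLp u r μ) : MemLp (Kop κ u) r μ :=
  ⟨aestronglyMeasurable_Kop hκ hu.1, (eLpNorm_Kop_le hκ hr hr' hu.1).trans_lt hu.2⟩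

lemma integrable_Kop (hκ : κ.Invariant μ) {u : ℝ → ℝ} (hu : Integrable u μ) :
    Integrable (Kop κ u) μ :=
  memLp_one_iff_integrable.1
    (memLp_Kop hκ le_rfl ENNReal.one_ne_top (memLp_one_iff_integrable.2 hu))

lemma integral_Kop (hκ : κ.Invariant μ) {u : ℝ → ℝ} (hu : Integrable u μ) :
    ∫ x, Kop κ u x ∂μ = ∫ x, u x ∂μ := by
  have e : (κ ∘ₖ Kernel.const Unit μ) () = μ := by
    rw [← Measure.comp_eq_comp_const_apply, hκ.def]
  have h := Kernel.integral_comp (η := κ) (κ := Kernel.const Unit μ) (a := ()) (f := u) (by rwa [e])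
  rw [e, Kernel.const_apply] at h
  exact h.symm

lemma Kop_add (hκ : κ.Invariant μ) {u v : ℝ → ℝ} (hu : Integrable u μ) (hv : Integrable v μ) :
    Kop κ (fun x => u x + v x) =ᵐ[μ] fun x => Kop κ u x + Kop κ v x := by
  filter_upwards [ae_integrable_of_invariant hκ hu, ae_integrable_of_invariant hκ hv]
    with x h1 h2 using integral_add h1 h2

lemma Kop_const_mul (c : ℝ) (u : ℝ → ℝ) :
    Kop κ (fun x => c * u x) = fun x => c * Kop κ u x := by
  funext x; exact integral_const_mul c u

lemma Kop_finset_sum (hκ : κ.Invariant μ) {ι : Type*} (s : Finset ι) {u : ι → ℝ → ℝ}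
    (hu : ∀ i ∈ s, Integrable (u i) μ) :
    Kop κ (fun x => ∑ i ∈ s, u i x) =ᵐ[μ] fun x => ∑ i ∈ s, Kop κ (u i) x := by
  have : ∀ᵐ x ∂μ, ∀ i ∈ s, Integrable (u i) (κ x) := by
    rw [Filter.eventually_all_finset]
    exact fun i hi => ae_integrable_of_invariant hκ (hu i hi)
  filter_upwards [this] with x hx using integral_finsetSum _ hx

lemma Kop_sub_const (hκ : κ.Invariant μ) {u : ℝ → ℝ} (hu : Integrable u μ) (c : ℝ) :
    Kop κ (fun x => u x - c) =ᵐ[μ] fun x => Kop κ u x - c := by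
  filter_upwards [ae_integrable_of_invariant hκ hu] with x h1
  simp [Kop, integral_sub h1 (integrable_const c)]

/-- The centred transition operator `u ↦ κ u - μ(u)`. -/
def centeredOp (κ : Kernel ℝ ℝ) (μ : Measure ℝ) (u : ℝ → ℝ) : ℝ → ℝ :=
  fun x => Kop κ u x - ∫ y, u y ∂μ

lemma centeredOp_add (hκ : κ.Invariant μ) {u v : ℝ → ℝ} (hu : Integrable u μ)
    (hv : Integrable v μ) :
    centeredOp κ μ (fun x => u x + v x) =ᵐ[μ]
      fun x => centeredOp κ μ u x + centeredOp κ μ v x := by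
  filter_upwards [Kop_add hκ hu hv] with x hx
  simp only [centeredOp, hx, integral_add hu hv]
  ring

lemma centeredOp_const_mul (c : ℝ) (u : ℝ → ℝ) :
    centeredOp κ μ (fun x => c * u x) = fun x => c * centeredOp κ μ u x := by
  funext x
  simp only [centeredOp, Kop_const_mul, integral_const_mul]
  ring

lemma centeredOp_sub (hκ : κ.Invariant μ) {u v : ℝ → ℝ} (hu : Integrable u μ)
    (hv : Integrable v μ) :
    centeredOp κ μ (fun x => u x - v x) =ᵐ[μ]
      fun x => centeredOp κ μ u x - centeredOp κ μ v x := by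
  have h := centeredOp_add hκ hu (hv.const_mul (-1))
  rw [centeredOp_const_mul] at h
  have e : (fun x => u x - v x) = fun x => u x + -1 * v x := by funext x; ring
  rw [e]
  filter_upwards [h] with x hx
  rw [hx]; ring

lemma centeredOp_finset_sum (hκ : κ.Invariant μ) {ι : Type*} (s : Finset ι) {u : ι → ℝ → ℝ}
    (hu : ∀ i ∈ s, Integrable (u i) μ) :
    centeredOp κ μ (fun x => ∑ i ∈ s, u i x) =ᵐ[μ] fun x => ∑ i ∈ s, centeredOp κ μ (u i) x := by
  filter_upwards [Kop_finset_sum hκ s hu] with x hx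
  simp only [centeredOp, hx, integral_finsetSum s hu, Finset.sum_sub_distrib]

lemma aestronglyMeasurable_centeredOp (hκ : κ.Invariant μ) {u : ℝ → ℝ}
    (hu : AEStronglyMeasurable u μ) : AEStronglyMeasurable (centeredOp κ μ u) μ :=
  (aestronglyMeasurable_Kop hκ hu).sub aestronglyMeasurable_const

lemma eLpNorm_centeredOp_le (hκ : κ.Invariant μ) {r : ℝ≥0∞} (hr : 1 ≤ r) (hr' : r ≠ ∞)
    {u : ℝ → ℝ} (hu : AEStronglyMeasurable u μ) :
    eLpNorm (centeredOp κ μ u) r μ ≤ 2 * eLpNorm u r μ := by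
  have h1 : eLpNorm (fun _ : ℝ => ∫ y, u y ∂μ) r μ ≤ eLpNorm u r μ := by
    rw [eLpNorm_const _ (zero_lt_one.trans_le hr).ne' (IsProbabilityMeasure.ne_zero μ)]
    simp only [measure_univ, ENNReal.one_rpow, mul_one]
    refine (enorm_integral_le_lintegral_enorm u).trans ?_
    rw [← eLpNorm_one_eq_lintegral_enorm]
    exact eLpNorm_le_eLpNorm_of_exponent_le hr hu
  calc eLpNorm (centeredOp κ μ u) r μ
      ≤ eLpNorm (Kop κ u) r μ + eLpNorm (fun _ : ℝ => ∫ y, u y ∂μ) r μ :=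
        eLpNorm_sub_le (aestronglyMeasurable_Kop hκ hu) aestronglyMeasurable_const hr
    _ ≤ eLpNorm u r μ + eLpNorm u r μ := add_le_add (eLpNorm_Kop_le hκ hr hr' hu) h1
    _ = _ := (two_mul _).symm

lemma memLp_centeredOp (hκ : κ.Invariant μ) {r : ℝ≥0∞} (hr : 1 ≤ r) (hr' : r ≠ ∞) {u : ℝ → ℝ}
    (hu : MemLp u r μ) : MemLp (centeredOp κ μ u) r μ :=
  (memLp_Kop hκ hr hr' hu).sub (memLp_const _)

lemma integrable_centeredOp (hκ : κ.Invariant μ) {u : ℝ → ℝ} (hu : Integrable u μ) :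
    Integrable (centeredOp κ μ u) μ :=
  (integrable_Kop hκ hu).sub (integrable_const _)

lemma abs_centeredOp_le {u : ℝ → ℝ} {B : ℝ} (hB : ∀ x, |u x| ≤ B) (x : ℝ) :
    |centeredOp κ μ u x| ≤ 2 * B := by
  have h1 : |Kop κ u x| ≤ B := by
    simpa [Kop] using norm_integral_le_of_norm_le_const (μ := κ x) (f := u) (C := B) (ae_of_all _ hB)
  have h2 : |∫ y, u y ∂μ| ≤ B := by
    simpa using norm_integral_le_of_norm_le_const (μ := μ) (f := u) (C := B) (ae_of_all _ hB)
  unfold centeredOp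
  linarith [abs_sub (Kop κ u x) (∫ y, u y ∂μ)]

end InvariantKernel

section KernelIterates

set_option linter.unusedSectionVars false

/-- Iterated composition of a transition kernel with itself. -/
def iterKernel (K : Kernel ℝ ℝ) : ℕ → Kernel ℝ ℝ
  | 0 => Kernel.id
  | n + 1 => iterKernel K n ∘ₖ K

variable {μ : Measure ℝ} [IsProbabilityMeasure μ] {K : Kernel ℝ ℝ} [IsMarkovKernel K]

instance isMarkovKernel_iterKernel (n : ℕ) : IsMarkovKernel (iterKernel K n) := by
  induction n with
  | zero => unfold iterKernel; infer_instance
  | succ n ih => unfold iterKernel; infer_instance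

lemma invariant_iterKernel (hK : K.Invariant μ) (n : ℕ) : (iterKernel K n).Invariant μ := by
  induction n with
  | zero =>
    change μ.bind Kernel.id = μ
    rw [Measure.id_comp]
  | succ n ih => exact ih.comp hK

lemma Kop_iterKernel_succ (hK : K.Invariant μ) (n : ℕ) {u : ℝ → ℝ} (hu : Integrable u μ) :
    Kop (iterKernel K (n + 1)) u =ᵐ[μ] Kop K (Kop (iterKernel K n) u) := by
  filter_upwards [ae_integrable_of_invariant (invariant_iterKernel hK (n + 1)) hu] with x hx
  exact Kernel.integral_comp hx

lemma iterate_Kop_ae_eq (hK : K.Invariant μ) (n : ℕ) {u : ℝ → ℝ} (hu : Integrable u μ) :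
    (Kop K)^[n] u =ᵐ[μ] Kop (iterKernel K n) u := by
  induction n with
  | zero =>
    wlog hm : Measurable u generalizing u
    · have h := this (hu.congr hu.1.ae_eq_mk) hu.1.stronglyMeasurable_mk.measurable
      exact (hu.1.ae_eq_mk.trans h).trans
        (Kop_congr_ae (invariant_iterKernel hK 0) hu.1.ae_eq_mk).symm
    refine ae_of_all _ fun x => ?_
    simp [Kop, iterKernel, Kernel.id_apply, integral_dirac' _ _ hm.stronglyMeasurable]
  | succ n ih =>
    rw [Function.iterate_succ_apply']
    exact (Kop_congr_ae hK ih).trans (Kop_iterKernel_succ hK n hu).symm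

lemma Kop_centeredOp_iterKernel (hK : K.Invariant μ) (n : ℕ) {u : ℝ → ℝ}
    (hu : Integrable u μ) :
    Kop K (centeredOp (iterKernel K n) μ u) =ᵐ[μ] centeredOp (iterKernel K (n + 1)) μ u := by
  have h1 := Kop_sub_const hK (integrable_Kop (invariant_iterKernel hK n) hu) (∫ y, u y ∂μ)
  filter_upwards [h1, Kop_iterKernel_succ hK n hu] with x h1 h2
  simp only [centeredOp, h2]
  exact h1

lemma centeredOp_iterKernel_zero (hK : K.Invariant μ) {u : ℝ → ℝ} (hu : Integrable u μ) :
    centeredOp (iterKernel K 0) μ u =ᵐ[μ] fun x => u x - ∫ y, u y ∂μ := by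
  filter_upwards [iterate_Kop_ae_eq hK 0 hu] with x hx
  simp [centeredOp, ← hx]

lemma abs_indic_le (t x : ℝ) : |indic t x| ≤ 1 := by
  unfold indic
  by_cases h : x ∈ Set.Iic t <;> simp [h]

lemma integrable_indic (t : ℝ) : Integrable (indic t) μ :=
  (integrable_const (1 : ℝ)).indicator measurableSet_Iic

lemma integral_abs_iterate_indic (hK : K.Invariant μ) (n : ℕ) (t : ℝ) :
    ∫ x, |(Kop K)^[n] (indic t) x - ∫ y, indic t y ∂μ| ∂μ
      = ∫ x, |centeredOp (iterKernel K n) μ (indic t) x| ∂μ := by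
  refine integral_congr_ae ?_
  filter_upwards [iterate_Kop_ae_eq hK n (integrable_indic t)] with x hx
  rw [hx, centeredOp]

lemma bddAbove_alpha1 (hK : K.Invariant μ) (n : ℕ) :
    BddAbove (range fun t : ℝ => ∫ x, |(Kop K)^[n] (indic t) x - ∫ y, indic t y ∂μ| ∂μ) := by
  refine ⟨2 * 1, ?_⟩
  rintro _ ⟨t, rfl⟩
  simp only [integral_abs_iterate_indic hK]
  have h := norm_integral_le_of_norm_le_const (μ := μ) (C := 2 * 1)
    (f := fun x => |centeredOp (iterKernel K n) μ (indic t) x|)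
    (ae_of_all _ fun x => by
      rw [Real.norm_eq_abs, abs_abs]
      exact abs_centeredOp_le (abs_indic_le t) x)
  simpa using (le_abs_self _).trans h

lemma integral_abs_centeredOp_indic_le_alpha1 (hK : K.Invariant μ) (n : ℕ) (t : ℝ) :
    ∫ x, |centeredOp (iterKernel K n) μ (indic t) x| ∂μ ≤ alpha1 (Kop K) μ n := by
  rw [← integral_abs_iterate_indic hK]
  exact le_ciSup (bddAbove_alpha1 hK n) t

lemma alpha1_nonneg (k : (ℝ → ℝ) → ℝ → ℝ) (n : ℕ) : 0 ≤ alpha1 k μ n :=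
  Real.iSup_nonneg fun _ => integral_nonneg fun _ => abs_nonneg _

lemma integral_abs_Kop_le (hK : K.Invariant μ) {u : ℝ → ℝ} (hu : Integrable u μ) :
    ∫ x, |Kop K u x| ∂μ ≤ ∫ x, |u x| ∂μ := by
  rw [← integral_Kop hK hu.abs]
  refine integral_mono (integrable_Kop hK hu).abs (integrable_Kop hK hu.abs) fun x => ?_
  exact norm_integral_le_integral_norm u

lemma antitone_alpha1 (hK : K.Invariant μ) : Antitone (alpha1 (Kop K) μ) := by
  refine antitone_nat_of_succ_le fun n => ciSup_le fun t => ?_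
  rw [integral_abs_iterate_indic hK]
  refine le_trans ?_ (integral_abs_centeredOp_indic_le_alpha1 hK n t)
  refine (integral_congr_ae
    ((Kop_centeredOp_iterKernel hK n (integrable_indic t)).fun_comp abs)).symm.trans_le ?_
  exact integral_abs_Kop_le hK (integrable_centeredOp (invariant_iterKernel hK n)
    (integrable_indic t))

end KernelIterates

section MonotoneBound

set_option linter.unusedSectionVars false

variable {μ : Measure ℝ} [IsProbabilityMeasure μ] {κ : Kernel ℝ ℝ} [IsMarkovKernel κ]

lemma integral_abs_centeredOp_add_le (hκ : κ.Invariant μ) {u v : ℝ → ℝ} (hu : Integrable u μ)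
    (hv : Integrable v μ) :
    ∫ x, |centeredOp κ μ (fun x => u x + v x) x| ∂μ
      ≤ ∫ x, |centeredOp κ μ u x| ∂μ + ∫ x, |centeredOp κ μ v x| ∂μ := by
  have iu := (integrable_centeredOp hκ hu).abs
  have iv := (integrable_centeredOp hκ hv).abs
  rw [← integral_add iu iv]
  refine integral_mono_ae (integrable_centeredOp hκ (hu.add hv)).abs (iu.add iv) ?_
  filter_upwards [centeredOp_add hκ hu hv] with x hx
  rw [hx]
  exact abs_add_le _ _

lemma integral_abs_centeredOp_const_mul (c : ℝ) (u : ℝ → ℝ) :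
    ∫ x, |centeredOp κ μ (fun x => c * u x) x| ∂μ = |c| * ∫ x, |centeredOp κ μ u x| ∂μ := by
  simp only [centeredOp_const_mul, abs_mul, integral_const_mul]

lemma integral_abs_centeredOp_sub_le (hκ : κ.Invariant μ) {u v : ℝ → ℝ} (hu : Integrable u μ)
    (hv : Integrable v μ) :
    ∫ x, |centeredOp κ μ (fun x => u x - v x) x| ∂μ
      ≤ ∫ x, |centeredOp κ μ u x| ∂μ + ∫ x, |centeredOp κ μ v x| ∂μ := by
  have h := integral_abs_centeredOp_add_le hκ hu (hv.const_mul (-1))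
  rw [integral_abs_centeredOp_const_mul] at h
  simpa [sub_eq_add_neg] using h

lemma integral_abs_centeredOp_finset_sum_le (hκ : κ.Invariant μ) {ι : Type*} (s : Finset ι)
    {u : ι → ℝ → ℝ} (hu : ∀ i ∈ s, Integrable (u i) μ) :
    ∫ x, |centeredOp κ μ (fun x => ∑ i ∈ s, u i x) x| ∂μ
      ≤ ∑ i ∈ s, ∫ x, |centeredOp κ μ (u i) x| ∂μ := by
  have iu : ∀ i ∈ s, Integrable (fun x => |centeredOp κ μ (u i) x|) μ :=
    fun i hi => (integrable_centeredOp hκ (hu i hi)).abs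
  rw [← integral_finsetSum s iu]
  refine integral_mono_ae (integrable_centeredOp hκ (integrable_finsetSum s hu)).abs
    (integrable_finsetSum s iu) ?_
  filter_upwards [centeredOp_finset_sum hκ s hu] with x hx
  rw [hx]
  exact Finset.abs_sum_le_sum_abs _ _

lemma integral_abs_centeredOp_le (hκ : κ.Invariant μ) {u : ℝ → ℝ} (hu : Integrable u μ) :
    ∫ x, |centeredOp κ μ u x| ∂μ ≤ 2 * ∫ x, |u x| ∂μ := by
  have h1 := (integrable_Kop hκ hu).abs
  calc ∫ x, |centeredOp κ μ u x| ∂μ ≤ ∫ x, (|Kop κ u x| + |∫ y, u y ∂μ|) ∂μ :=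
        integral_mono (integrable_centeredOp hκ hu).abs (h1.add (integrable_const _))
          fun x => abs_sub _ _
    _ = ∫ x, |Kop κ u x| ∂μ + |∫ y, u y ∂μ| := by
        rw [integral_add h1 (integrable_const _)]; simp
    _ ≤ ∫ x, |u x| ∂μ + ∫ x, |u x| ∂μ :=
        add_le_add (integral_abs_Kop_le hκ hu) abs_integral_le_integral_abs
    _ = _ := (two_mul _).symm

lemma centeredOp_const (c : ℝ) : centeredOp κ μ (fun _ => c) = fun _ => 0 := by
  funext x; simp [centeredOp, Kop]

lemma isLowerSet_eq_univ_or_empty_or_Iic_or_Iio {D : Set ℝ} (hD : IsLowerSet D) :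
    D = univ ∨ D = ∅ ∨ ∃ s, D = Iic s ∨ D = Iio s := by
  rcases D.eq_empty_or_nonempty with rfl | hne
  · simp
  by_cases hb : BddAbove D
  · right; right
    refine ⟨sSup D, ?_⟩
    by_cases hs : sSup D ∈ D
    · left
      exact Subset.antisymm (fun x hx => le_csSup hb hx) fun x hx => hD hx hs
    · right
      refine Subset.antisymm (fun x hx => (le_csSup hb hx).lt_of_ne ?_) fun x hx => ?_
      · rintro rfl; exact hs hx
      · obtain ⟨y, hy, hxy⟩ := exists_lt_of_lt_csSup hne hx
        exact hD hxy.le hy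
  · left
    refine eq_univ_of_forall fun x => ?_
    rw [not_bddAbove_iff] at hb
    obtain ⟨y, hy, hxy⟩ := hb x
    exact hD hxy.le hy

variable {a : ℝ}

lemma integral_abs_centeredOp_Iio_le (hκ : κ.Invariant μ)
    (ha : ∀ t, ∫ x, |centeredOp κ μ (indic t) x| ∂μ ≤ a) (s : ℝ) :
    ∫ x, |centeredOp κ μ ((Iio s).indicator fun _ => 1) x| ∂μ ≤ a := by
  have hs : Integrable ((Iio s).indicator fun _ => (1 : ℝ)) μ :=
    (integrable_const _).indicator measurableSet_Iio
  obtain ⟨t, ht_mono, ht_lt, ht_lim⟩ := exists_seq_strictMono_tendsto s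
  have hlim : Tendsto (fun j => ∫ x, |(Iio s).indicator (fun _ => (1 : ℝ)) x - indic (t j) x| ∂μ)
      atTop (𝓝 (∫ _, (0 : ℝ) ∂μ)) := by
    refine tendsto_integral_of_dominated_convergence (fun _ => 2)
      (fun j => (hs.sub (integrable_indic (t j))).abs.1) (integrable_const _) ?_ ?_
    · refine fun j => ae_of_all _ fun x => ?_
      rw [Real.norm_eq_abs, abs_abs]
      have h1 : |(Iio s).indicator (fun _ => (1 : ℝ)) x| ≤ 1 := by
        by_cases h : x ∈ Iio s <;> simp [h]
      linarith [abs_sub ((Iio s).indicator (fun _ => (1 : ℝ)) x) (indic (t j) x),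
        abs_indic_le (t j) x]
    · refine ae_of_all _ fun x => tendsto_const_nhds.congr' ?_
      by_cases hx : x < s
      · filter_upwards [ht_lim.eventually (lt_mem_nhds hx)] with j hj
        simp [indic, hx, hj.le]
      · filter_upwards with j
        have : ¬ x ≤ t j := fun h => hx (h.trans_lt (ht_lt j))
        simp [indic, hx, this]
  have hbound : ∀ j, ∫ x, |centeredOp κ μ ((Iio s).indicator fun _ => 1) x| ∂μ
      ≤ 2 * ∫ x, |(Iio s).indicator (fun _ => (1 : ℝ)) x - indic (t j) x| ∂μ + a := by
    intro j
    have h := integral_abs_centeredOp_add_le hκ (hs.sub (integrable_indic (t j)))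
      (integrable_indic (t j))
    simp only [Pi.sub_apply, sub_add_cancel] at h
    refine h.trans (add_le_add ?_ (ha _))
    exact integral_abs_centeredOp_le hκ (hs.sub (integrable_indic (t j)))
  have := (hlim.const_mul 2).add_const a
  simp only [integral_zero, mul_zero, zero_add] at this
  exact ge_of_tendsto' this hbound

lemma integral_abs_centeredOp_isLowerSet_le (hκ : κ.Invariant μ)
    (ha : ∀ t, ∫ x, |centeredOp κ μ (indic t) x| ∂μ ≤ a) {D : Set ℝ} (hD : IsLowerSet D) :
    ∫ x, |centeredOp κ μ (D.indicator fun _ => 1) x| ∂μ ≤ a := by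
  have ha0 : 0 ≤ a := (integral_nonneg fun _ => abs_nonneg _).trans (ha 0)
  rcases isLowerSet_eq_univ_or_empty_or_Iic_or_Iio hD with rfl | rfl | ⟨s, rfl | rfl⟩
  · simpa [centeredOp_const] using ha0
  · simpa [centeredOp_const] using ha0
  · exact ha s
  · exact integral_abs_centeredOp_Iio_le hκ ha s

lemma integral_abs_centeredOp_ordConnected_le (hκ : κ.Invariant μ)
    (ha : ∀ t, ∫ x, |centeredOp κ μ (indic t) x| ∂μ ≤ a) {J : Set ℝ} (hJ : J.OrdConnected) :
    ∫ x, |centeredOp κ μ (J.indicator fun _ => 1) x| ∂μ ≤ 2 * a := by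
  have h1 : IsLowerSet (lowerClosure J : Set ℝ) := (lowerClosure J).lower
  have h2 : IsLowerSet ((lowerClosure J : Set ℝ) \ J) := by
    rintro x y hyx ⟨hx, hxJ⟩
    refine ⟨h1 hyx hx, fun hy => hxJ ?_⟩
    obtain ⟨j, hj, hxj⟩ := hx
    exact hJ.out hy hj ⟨hyx, hxj⟩
  have int : ∀ {D : Set ℝ}, IsLowerSet D → Integrable (D.indicator fun _ => (1 : ℝ)) μ :=
    fun hD => (integrable_const _).indicator hD.ordConnected.measurableSet
  have h := integral_abs_centeredOp_sub_le hκ (int h1) (int h2)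
  have e : (fun x => (lowerClosure J : Set ℝ).indicator (fun _ => (1 : ℝ)) x
      - ((lowerClosure J : Set ℝ) \ J).indicator (fun _ => (1 : ℝ)) x)
      = J.indicator fun _ => 1 := by
    funext x
    by_cases hx : x ∈ J
    · simp [hx, subset_lowerClosure hx]
    · by_cases hx' : x ∈ lowerClosure J <;> simp [hx, hx', indicator]
  rw [e] at h
  linarith [integral_abs_centeredOp_isLowerSet_le hκ ha h1,
    integral_abs_centeredOp_isLowerSet_le hκ ha h2]

lemma integral_abs_centeredOp_compl_ordConnected_le (hκ : κ.Invariant μ)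
    (ha : ∀ t, ∫ x, |centeredOp κ μ (indic t) x| ∂μ ≤ a) {J : Set ℝ} (hJ : Jᶜ.OrdConnected) :
    ∫ x, |centeredOp κ μ (J.indicator fun _ => 1) x| ∂μ ≤ 2 * a := by
  have h := integral_abs_centeredOp_sub_le hκ (integrable_const (1 : ℝ))
    ((integrable_const (1 : ℝ)).indicator (s := Jᶜ) hJ.measurableSet)
  have e : (fun x => (1 : ℝ) - Jᶜ.indicator (fun _ => (1 : ℝ)) x) = J.indicator fun _ => 1 := by
    funext x
    by_cases hx : x ∈ J <;> simp [hx]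
  rw [e, centeredOp_const] at h
  simp only [abs_zero, integral_zero, zero_add] at h
  exact h.trans (integral_abs_centeredOp_ordConnected_le hκ ha hJ)

lemma sum_range_ite_succ_le_eq_floor {n : ℕ} {y : ℝ} (hy : 0 ≤ y) (hn : y ≤ n) :
    ∑ j ∈ Finset.range n, (if ((j : ℝ) + 1 ≤ y) then (1 : ℝ) else 0) = ⌊y⌋₊ := by
  rw [← Finset.sum_filter]
  have : (Finset.range n).filter (fun j : ℕ => (j : ℝ) + 1 ≤ y) = Finset.range ⌊y⌋₊ := by
    ext j
    have h1 : (j : ℝ) + 1 ≤ y ↔ j + 1 ≤ ⌊y⌋₊ := by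
      rw [Nat.le_floor_iff hy]; push_cast; rfl
    have h2 : ⌊y⌋₊ ≤ n := by
      have := (Nat.floor_le hy).trans hn
      exact_mod_cast this
    simp only [Finset.mem_filter, Finset.mem_range, h1]
    omega
  rw [this]; simp

/-- A bounded function all of whose superlevel sets are intervals or complements of intervals
satisfies the same mixing bound as the half-line indicators, up to a constant. -/
lemma integral_abs_centeredOp_le_of_levelSets (hκ : κ.Invariant μ)
    (ha : ∀ t, ∫ x, |centeredOp κ μ (indic t) x| ∂μ ≤ a) {u : ℝ → ℝ} {B : ℝ} (hB : 0 < B)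
    (hu : ∀ s, {x | s ≤ u x}.OrdConnected ∨ {x | s ≤ u x}ᶜ.OrdConnected)
    (huB : ∀ x, |u x| ≤ B) :
    ∫ x, |centeredOp κ μ u x| ∂μ ≤ 4 * B * a := by
  have hmeas : ∀ s, MeasurableSet {x | s ≤ u x} := fun s => by
    rcases hu s with h | h
    · exact h.measurableSet
    · exact h.measurableSet.of_compl
  have hum : Measurable u := measurable_of_Ici hmeas
  have hui : Integrable u μ :=
    (integrable_const B).mono' hum.aestronglyMeasurable (ae_of_all _ huB)
  have hone : ∀ s, Integrable ({x | s ≤ u x}.indicator fun _ => (1 : ℝ)) μ :=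
    fun s => (integrable_const _).indicator (hmeas s)
  have key : ∀ n : ℕ, ∫ x, |centeredOp κ μ u x| ∂μ ≤ 4 * B * a + 2 * (B / (n + 1 : ℝ)) := by
    intro n
    set N : ℝ := n + 1 with hN
    have hNpos : 0 < N := by positivity
    set δ : ℝ := B / N with hδ
    have hδpos : 0 < δ := by positivity
    have hNδ : N * δ = B := by rw [hδ]; field_simp
    set L : ℕ → Set ℝ := fun j => {x | -B + ((j : ℝ) + 1) * δ ≤ u x} with hL
    set w : ℝ → ℝ := fun x => ∑ j ∈ Finset.range (2 * (n + 1)),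
      δ * (L j).indicator (fun _ => 1) x with hw
    have hwi' : ∀ j ∈ Finset.range (2 * (n + 1)),
        Integrable (fun x => δ * (L j).indicator (fun _ => (1 : ℝ)) x) μ :=
      fun j _ => (hone _).const_mul _
    have hwi : Integrable w μ := integrable_finsetSum _ hwi'
    have hdist : ∀ x, |u x - (w x - B)| ≤ δ := by
      intro x
      obtain ⟨hx1, hx2⟩ := abs_le.1 (huB x)
      have hy0 : 0 ≤ (u x + B) / δ := div_nonneg (by linarith) hδpos.le
      have hyn : (u x + B) / δ ≤ ((2 * (n + 1) : ℕ) : ℝ) := by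
        rw [div_le_iff₀ hδpos]; push_cast; rw [← hN]; nlinarith
      have hwx : w x = δ * ⌊(u x + B) / δ⌋₊ := by
        rw [← sum_range_ite_succ_le_eq_floor hy0 hyn, hw, Finset.mul_sum]
        refine Finset.sum_congr rfl fun j _ => ?_
        simp only [hL, indicator, mem_ofPred_eq]
        congr 1
        refine if_congr ?_ rfl rfl
        rw [le_div_iff₀ hδpos]
        constructor <;> intro h <;> linarith
      have f1 := Nat.floor_le hy0
      have f2 := Nat.lt_floor_add_one ((u x + B) / δ)
      rw [le_div_iff₀ hδpos] at f1
      rw [div_lt_iff₀ hδpos] at f2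
      rw [hwx, abs_le]
      constructor <;> nlinarith
    have hd : ∫ x, |u x - (w x - B)| ∂μ ≤ δ := by
      calc ∫ x, |u x - (w x - B)| ∂μ ≤ ∫ _, δ ∂μ :=
            integral_mono (hui.sub (hwi.sub (integrable_const _))).abs (integrable_const _) hdist
        _ = δ := by simp
    have hwb : ∫ x, |centeredOp κ μ w x| ∂μ ≤ 4 * B * a := by
      calc ∫ x, |centeredOp κ μ w x| ∂μ
          ≤ ∑ j ∈ Finset.range (2 * (n + 1)),
            ∫ x, |centeredOp κ μ (fun x => δ * (L j).indicator (fun _ => 1) x) x| ∂μ :=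
            integral_abs_centeredOp_finset_sum_le hκ _ hwi'
        _ ≤ ∑ j ∈ Finset.range (2 * (n + 1)), δ * (2 * a) := by
            refine Finset.sum_le_sum fun j _ => ?_
            rw [integral_abs_centeredOp_const_mul, abs_of_pos hδpos]
            refine mul_le_mul_of_nonneg_left ?_ hδpos.le
            rcases hu (-B + ((j : ℝ) + 1) * δ) with h | h
            · exact integral_abs_centeredOp_ordConnected_le hκ ha h
            · exact integral_abs_centeredOp_compl_ordConnected_le hκ ha h
        _ = 4 * B * a := by
            simp only [Finset.sum_const, Finset.card_range, nsmul_eq_mul]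
            push_cast; rw [← hN, ← hNδ]; ring
    have h1 := integral_abs_centeredOp_sub_le hκ hwi (integrable_const (-(-B)))
    have h2 := integral_abs_centeredOp_add_le hκ (hwi.sub (integrable_const B))
      (hui.sub (hwi.sub (integrable_const B)))
    have h3 := integral_abs_centeredOp_le hκ (hui.sub (hwi.sub (integrable_const B)))
    simp only [centeredOp_const, neg_neg, abs_zero, integral_zero, add_zero] at h1
    simp only [Pi.sub_apply, add_sub_cancel] at h2 h3
    have h2' : ∫ x, |centeredOp κ μ u x| ∂μ ≤ ∫ x, |centeredOp κ μ (fun x => w x - B) x| ∂μ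
      + ∫ x, |centeredOp κ μ (u - (w - fun _ => B)) x| ∂μ := h2
    linarith
  have hlim : Tendsto (fun n : ℕ => 4 * B * a + 2 * (B / (n + 1 : ℝ))) atTop
      (𝓝 (4 * B * a + 2 * 0)) := by
    refine tendsto_const_nhds.add (Tendsto.const_mul 2 ?_)
    have := (tendsto_one_div_add_atTop_nhds_zero_nat (𝕜 := ℝ)).const_mul B
    simpa [div_eq_mul_inv] using this
  have := ge_of_tendsto' hlim key
  linarith

end MonotoneBound

section Truncation

set_option linter.unusedSectionVars false

/-- Truncation of a real number at level `B`. -/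
def clamp (B y : ℝ) : ℝ := max (-B) (min y B)

lemma monotone_clamp (B : ℝ) : Monotone (clamp B) :=
  fun _ _ h => max_le_max_left _ (min_le_min_right _ h)

lemma abs_clamp_le {B : ℝ} (hB : 0 ≤ B) (y : ℝ) : |clamp B y| ≤ B := by
  unfold clamp
  exact abs_le.2 ⟨le_max_left _ _, max_le (by linarith) (min_le_right _ _)⟩

lemma clamp_zero {B : ℝ} (hB : 0 ≤ B) : clamp B 0 = 0 := by
  simp [clamp, hB]

lemma abs_sub_clamp {B : ℝ} (hB : 0 ≤ B) (y : ℝ) : |y - clamp B y| = max (|y| - B) 0 := by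
  unfold clamp
  rcases lt_or_ge y (-B) with h1 | h1
  · rw [min_eq_left (by linarith), max_eq_left h1.le, abs_of_nonpos (by linarith),
      abs_of_nonpos (by linarith), max_eq_left (by linarith)]
    ring
  · rcases le_or_gt y B with h2 | h2
    · rw [min_eq_left h2, max_eq_right h1, max_eq_right (by linarith [abs_le.2 ⟨h1, h2⟩])]
      simp
    · rw [min_eq_right h2.le, max_eq_right (by linarith), abs_of_nonneg (by linarith),
        abs_of_nonneg (by linarith), max_eq_left (by linarith)]

lemma measurable_clamp (B : ℝ) : Measurable (clamp B) := (monotone_clamp B).measurable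

lemma ordConnected_levelSet {I : Set ℝ} (hI : I.OrdConnected) {h : ℝ → ℝ}
    (hm : MonotoneOn h I ∨ AntitoneOn h I) (h0 : ∀ x ∉ I, h x = 0) (s : ℝ) :
    {x | s ≤ h x}.OrdConnected ∨ {x | s ≤ h x}ᶜ.OrdConnected := by
  rcases lt_or_ge 0 s with hs | hs
  · have hin : ∀ x, s ≤ h x → x ∈ I := fun x hx => by
      by_contra hxI
      rw [h0 x hxI] at hx
      exact absurd hx (not_le.2 hs)
    refine Or.inl ⟨fun x hx z hz y hy => ?_⟩
    have hx' : s ≤ h x := hx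
    have hz' : s ≤ h z := hz
    have hyI := hI.out (hin x hx) (hin z hz) hy
    rcases hm with hm | hm
    · exact hx'.trans (hm (hin x hx) hyI hy.1)
    · exact hz'.trans (hm hyI (hin z hz) hy.2)
  · have hin : ∀ x, h x < s → x ∈ I := fun x hx => by
      by_contra hxI
      rw [h0 x hxI] at hx
      exact absurd hx (not_lt.2 hs)
    refine Or.inr ⟨fun x hx z hz y hy => ?_⟩
    have hx' : h x < s := not_le.1 hx
    have hz' : h z < s := not_le.1 hz
    have hyI := hI.out (hin x hx') (hin z hz') hy
    refine (not_le.2 ?_ : ¬ s ≤ h y)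
    rcases hm with hm | hm
    · exact (hm hyI (hin z hz') hy.2).trans_lt hz'
    · exact (hm (hin x hx') hyI hy.1).trans_lt hx'

variable {μ : Measure ℝ} [IsProbabilityMeasure μ] {M : ℝ} {p : ℝ≥0∞} {g : ℝ → ℝ}

lemma Mon.measurable (hg : Mon M p μ g) : Measurable g := by
  obtain ⟨⟨I, -, hI, hm, h0⟩, -⟩ := hg
  refine measurable_of_Ici fun s => ?_
  rcases ordConnected_levelSet hI hm h0 s with h | h
  · exact h.measurableSet
  · exact h.measurableSet.of_compl

lemma Mon.ordConnected_levelSet_clamp (hg : Mon M p μ g) {B : ℝ} (hB : 0 ≤ B) (s : ℝ) :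
    {x | s ≤ clamp B (g x)}.OrdConnected ∨ {x | s ≤ clamp B (g x)}ᶜ.OrdConnected := by
  obtain ⟨⟨I, -, hI, hm, h0⟩, -⟩ := hg
  refine ordConnected_levelSet hI (h := fun x => clamp B (g x)) ?_ ?_ s
  · exact hm.imp (fun h x hx y hy hxy => monotone_clamp B (h hx hy hxy))
      (fun h x hx y hy hxy => monotone_clamp B (h hx hy hxy))
  · intro x hx
    simp only [h0 x hx, clamp_zero hB]

lemma lintegral_Ioi_zero_add_rpow {B s : ℝ} (hB : 0 < B) (hs : s < -1) :
    ∫⁻ t in Ioi (0 : ℝ), ENNReal.ofReal ((t + B) ^ s)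
      = ENNReal.ofReal (-B ^ (s + 1) / (s + 1)) := by
  rw [← integral_Ioi_rpow_of_lt hs hB,
    ofReal_integral_eq_lintegral_ofReal (integrableOn_Ioi_rpow_of_lt hs hB)
      ((ae_restrict_mem measurableSet_Ioi).mono fun t ht =>
        Real.rpow_nonneg (hB.trans ht).le _),
    ← lintegral_indicator measurableSet_Ioi, ← lintegral_indicator measurableSet_Ioi,
    ← lintegral_add_right_eq_self ((Ioi B).indicator fun t => ENNReal.ofReal (t ^ s)) B]
  refine lintegral_congr fun t => ?_
  simp [indicator]

lemma lintegral_rpow_excess_le (hg : Measurable g) {P r B D : ℝ} (hr : 1 ≤ r) (hrP : r < P)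
    (hB : 0 < B) (hD : 0 ≤ D)
    (h : ∀ t : ℝ, 0 < t → μ {x | t < |g x|} ≤ ENNReal.ofReal (D * t ^ (-P))) :
    ∫⁻ x, ENNReal.ofReal (max (|g x| - B) 0 ^ r) ∂μ
      ≤ ENNReal.ofReal (r / (P - r) * (D * B ^ (r - P))) := by
  have hm : Measurable fun x => max (|g x| - B) 0 := (hg.abs.sub_const B).max measurable_const
  rw [lintegral_rpow_eq_lintegral_meas_lt_mul μ (f := fun x => max (|g x| - B) 0) (ae_of_all _ fun x => le_max_right _ _)
    hm.aemeasurable (by linarith)]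
  have hle : ∀ t ∈ Ioi (0 : ℝ), μ {x | t < max (|g x| - B) 0} * ENNReal.ofReal (t ^ (r - 1))
      ≤ ENNReal.ofReal D * ENNReal.ofReal ((t + B) ^ (r - 1 - P)) := by
    intro t ht
    have ht0 : (0 : ℝ) < t := ht
    have htB : 0 < t + B := by linarith
    have h1 : μ {x | t < max (|g x| - B) 0} ≤ ENNReal.ofReal (D * (t + B) ^ (-P)) := by
      refine (measure_mono fun x hx => ?_).trans (h (t + B) htB)
      rcases lt_max_iff.1 (show t < max (|g x| - B) 0 from hx) with hx | hx
      · change t + B < |g x|; linarith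
      · exact absurd hx (not_lt.2 ht0.le)
    calc μ {x | t < max (|g x| - B) 0} * ENNReal.ofReal (t ^ (r - 1))
        ≤ ENNReal.ofReal (D * (t + B) ^ (-P)) * ENNReal.ofReal ((t + B) ^ (r - 1)) := by
          gcongr; linarith
      _ = _ := by
          rw [ENNReal.ofReal_mul hD, mul_assoc, ← ENNReal.ofReal_mul (by positivity),
            ← Real.rpow_add htB]
          ring_nf
  calc ENNReal.ofReal r * ∫⁻ t in Ioi 0, μ {x | t < max (|g x| - B) 0}
        * ENNReal.ofReal (t ^ (r - 1))
      ≤ ENNReal.ofReal r * ∫⁻ t in Ioi 0, ENNReal.ofReal D *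
        ENNReal.ofReal ((t + B) ^ (r - 1 - P)) := by
        gcongr 1
        exact setLIntegral_mono' measurableSet_Ioi hle
    _ = _ := by
        rw [lintegral_const_mul' _ _ ENNReal.ofReal_ne_top,
          lintegral_Ioi_zero_add_rpow hB (by linarith), ← ENNReal.ofReal_mul hD,
          ← ENNReal.ofReal_mul (by linarith)]
        congr 1
        have e : r - 1 - P + 1 = -(P - r) := by ring
        rw [e, show r - P = -(P - r) by ring]
        have : P - r ≠ 0 := by linarith
        field_simp

/-- Moments of the excess of an element of `Mon` over the level `M a^{-1/p}`. -/
lemma exists_eLpNorm_sub_clamp_le (hM : 0 < M) {r : ℝ≥0∞} (hr : 1 ≤ r) (hrp : r < p) :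
    ∃ C : ℝ, 0 ≤ C ∧ ∀ g, Mon M p μ g → ∀ a : ℝ, 0 < a →
      eLpNorm (fun x => g x - clamp (M * a ^ (-p⁻¹.toReal)) (g x)) r μ
        ≤ ENNReal.ofReal (C * a ^ (r⁻¹.toReal - p⁻¹.toReal)) := by
  have hr_top : r ≠ ∞ := hrp.ne_top
  have hr0 : r ≠ 0 := (zero_lt_one.trans_le hr).ne'
  set R := r.toReal with hR
  have hR1 : 1 ≤ R := by
    rw [hR, ← ENNReal.toReal_one]; exact ENNReal.toReal_mono hr_top hr
  by_cases hp : p = ∞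
  · subst hp
    refine ⟨0, le_rfl, fun g hg a ha => ?_⟩
    have h0 : ∀ᵐ x ∂μ, |g x| ≤ M := by
      have := hg.2
      rw [if_pos rfl] at this
      rw [ae_iff]
      simpa using this
    have : (fun x => g x - clamp (M * a ^ (-(∞ : ℝ≥0∞)⁻¹.toReal)) (g x)) =ᵐ[μ] fun _ => 0 := by
      filter_upwards [h0] with x hx
      rw [← abs_eq_zero, abs_sub_clamp (by positivity)]
      simpa using hx
    rw [eLpNorm_congr_ae this]
    simp
  · set P := p.toReal with hP
    have hRP : R < P := ENNReal.toReal_strict_mono hp hrp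
    refine ⟨(R / (P - R)) ^ (1 / R) * M, by
      have : 0 ≤ R / (P - R) := div_nonneg (by linarith) (by linarith)
      positivity, fun g hg a ha => ?_⟩
    rw [ENNReal.toReal_inv, ENNReal.toReal_inv, ← hP, ← hR]
    set B := M * a ^ (-P⁻¹) with hB
    have hBpos : 0 < B := by positivity
    have htail := hg.2
    rw [if_neg hp] at htail
    have key := lintegral_rpow_excess_le (μ := μ) hg.measurable hR1 hRP hBpos
      (by positivity : 0 ≤ M ^ P) htail
    rw [eLpNorm_eq_lintegral_rpow_enorm_toReal hr0 hr_top, ← hR]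
    have e : ∀ x, ‖g x - clamp B (g x)‖ₑ ^ R = ENNReal.ofReal (max (|g x| - B) 0 ^ R) := by
      intro x
      rw [← ofReal_norm, Real.norm_eq_abs, abs_sub_clamp hBpos.le,
        ENNReal.ofReal_rpow_of_nonneg (le_max_right _ _) (by linarith)]
    simp only [e]
    have hc : 0 ≤ R / (P - R) := div_nonneg (by linarith) (by linarith)
    calc (∫⁻ x, ENNReal.ofReal (max (|g x| - B) 0 ^ R) ∂μ) ^ (1 / R)
        ≤ ENNReal.ofReal (R / (P - R) * (M ^ P * B ^ (R - P))) ^ (1 / R) := by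
          gcongr
      _ = ENNReal.ofReal ((R / (P - R) * (M ^ P * B ^ (R - P))) ^ (1 / R)) :=
          ENNReal.ofReal_rpow_of_nonneg (by positivity) (by positivity)
      _ = _ := by
          congr 1
          have hP0 : P ≠ 0 := by linarith
          have hR0 : R ≠ 0 := by linarith
          rw [Real.mul_rpow hc (by positivity), mul_assoc]
          congr 1
          rw [hB, Real.mul_rpow hM.le (by positivity), ← mul_assoc, ← Real.rpow_add hM,
            ← Real.rpow_mul ha.le, Real.mul_rpow (by positivity) (by positivity),
            ← Real.rpow_mul hM.le, ← Real.rpow_mul ha.le]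
          rw [show (P + (R - P)) * (1 / R) = 1 by field_simp; ring, Real.rpow_one]
          congr 2
          field_simp
          ring

end Truncation

section Combination

set_option linter.unusedSectionVars false

/-- The conjugate exponent `(1 - 1/p)⁻¹` lies in `[1, 2)` when `2 < p`. -/
lemma one_le_conj (p : ℝ≥0∞) : 1 ≤ (1 - 1 / p)⁻¹ := by
  rw [ENNReal.one_le_inv]; exact tsub_le_self

lemma inv_lt_two_inv {p : ℝ≥0∞} (hp : 2 < p) : p⁻¹ < 2⁻¹ := ENNReal.inv_lt_inv.2 hp

lemma conj_lt_two {p : ℝ≥0∞} (hp : 2 < p) : (1 - 1 / p)⁻¹ < 2 := by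
  rw [ENNReal.inv_lt_iff_inv_lt, one_div, lt_tsub_iff_right]
  calc (2 : ℝ≥0∞)⁻¹ + p⁻¹ < 2⁻¹ + 2⁻¹ := by
        rw [ENNReal.add_lt_add_iff_left (by simp)]; exact inv_lt_two_inv hp
    _ = 1 := ENNReal.inv_two_add_inv_two

lemma toReal_inv_lt_half {p : ℝ≥0∞} (hp : 2 < p) : p⁻¹.toReal < 1 / 2 := by
  have := (ENNReal.toReal_lt_toReal (inv_lt_two_inv hp).ne_top (by simp)).2 (inv_lt_two_inv hp)
  simpa using this

lemma toReal_inv_conj {p : ℝ≥0∞} (hp : 2 < p) :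
    ((1 - 1 / p)⁻¹)⁻¹.toReal = 1 - p⁻¹.toReal := by
  rw [inv_inv, one_div, ENNReal.toReal_sub_of_le _ ENNReal.one_ne_top, ENNReal.toReal_one]
  exact (inv_lt_two_inv hp).le.trans (by simp)

lemma toReal_one_sub_two_div {p : ℝ≥0∞} (hp : 2 < p) :
    (1 - 2 / p).toReal = 1 - 2 * p⁻¹.toReal := by
  rw [ENNReal.toReal_sub_of_le _ ENNReal.one_ne_top, div_eq_mul_inv, ENNReal.toReal_mul]
  · simp
  · exact ENNReal.div_le_of_le_mul (by simpa using hp.le)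

variable {μ : Measure ℝ} [IsProbabilityMeasure μ] {M : ℝ} {p : ℝ≥0∞}

/-- Linear combinations of elements of `Mon` with coefficients of `ℓ¹`-norm at most one. -/
def IsMonComb (M : ℝ) (p : ℝ≥0∞) (μ : Measure ℝ) (w : ℝ → ℝ) : Prop :=
  ∃ (n : ℕ) (a : Fin n → ℝ) (g : Fin n → ℝ → ℝ),
    (∑ i, |a i|) ≤ 1 ∧ (∀ i, Mon M p μ (g i)) ∧ w = fun x => ∑ i, a i * g i x

lemma eLpNorm_sum_mul_le {n : ℕ} {a : Fin n → ℝ} (ha : ∑ i, |a i| ≤ 1) {v : Fin n → ℝ → ℝ}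
    (hv : ∀ i, Measurable (v i)) {r : ℝ≥0∞} (hr : 1 ≤ r) {D : ℝ}
    (h : ∀ i, eLpNorm (v i) r μ ≤ ENNReal.ofReal D) :
    eLpNorm (fun x => ∑ i, a i * v i x) r μ ≤ ENNReal.ofReal D := by
  have e : (fun x => ∑ i, a i * v i x) = ∑ i, a i • v i := by
    funext x; simp
  rw [e]
  calc eLpNorm (∑ i, a i • v i) r μ ≤ ∑ i, eLpNorm (a i • v i) r μ :=
        eLpNorm_sum_le (fun i _ => ((hv i).const_smul (a i)).aestronglyMeasurable) hr
    _ ≤ ∑ i, ENNReal.ofReal |a i| * ENNReal.ofReal D := by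
        refine Finset.sum_le_sum fun i _ => ?_
        rw [← Real.norm_eq_abs, ofReal_norm]
        exact eLpNorm_const_smul_le.trans (by gcongr; exact h i)
    _ = ENNReal.ofReal (∑ i, |a i|) * ENNReal.ofReal D := by
        rw [← Finset.sum_mul, ENNReal.ofReal_sum_of_nonneg fun _ _ => abs_nonneg _]
    _ ≤ 1 * ENNReal.ofReal D := by
        gcongr
        simpa using ENNReal.ofReal_le_ofReal ha
    _ = _ := one_mul _

/-- Splitting of a combination of monotone functions into a bounded part, controlled by the
mixing of level sets, and a remainder with small moments. -/
lemma exists_decomposition (hM : 0 < M) (hp : 2 < p) :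
    ∃ C : ℝ, 0 ≤ C ∧ ∀ w, IsMonComb M p μ w → ∀ a : ℝ, 0 < a →
      ∃ u v : ℝ → ℝ, Measurable u ∧ Measurable v ∧ (w = fun x => u x + v x) ∧
        (∀ x, |u x| ≤ M * a ^ (-p⁻¹.toReal)) ∧
        (∀ κ : Kernel ℝ ℝ, IsMarkovKernel κ → κ.Invariant μ →
          (∀ t, ∫ x, |centeredOp κ μ (indic t) x| ∂μ ≤ a) →
          ∫ x, |centeredOp κ μ u x| ∂μ ≤ 4 * (M * a ^ (-p⁻¹.toReal)) * a) ∧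
        eLpNorm v 1 μ ≤ ENNReal.ofReal (C * a ^ (1 - p⁻¹.toReal)) ∧
        eLpNorm v 2 μ ≤ ENNReal.ofReal (C * a ^ (1 / 2 - p⁻¹.toReal)) ∧
        eLpNorm v (1 - 1 / p)⁻¹ μ ≤ ENNReal.ofReal (C * a ^ (1 - 2 * p⁻¹.toReal)) := by
  obtain ⟨C₁, hC₁, h₁⟩ := exists_eLpNorm_sub_clamp_le (μ := μ) hM (r := 1) le_rfl
    (lt_trans (by norm_num) hp)
  obtain ⟨C₂, hC₂, h₂⟩ := exists_eLpNorm_sub_clamp_le (μ := μ) hM (r := 2) (by norm_num) hp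
  obtain ⟨C₃, hC₃, h₃⟩ := exists_eLpNorm_sub_clamp_le (μ := μ) hM (one_le_conj p)
    ((conj_lt_two hp).trans hp)
  refine ⟨C₁ + C₂ + C₃, by positivity, ?_⟩
  rintro w ⟨n, b, g, hb, hg, rfl⟩ a ha
  set B := M * a ^ (-p⁻¹.toReal) with hB
  have hB0 : 0 < B := by positivity
  have hmu : ∀ i, Measurable fun x => clamp B (g i x) :=
    fun i => (measurable_clamp B).comp (hg i).measurable
  have hmv : ∀ i, Measurable fun x => g i x - clamp B (g i x) :=
    fun i => (hg i).measurable.sub (hmu i)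
  have hmono : ∀ {c s : ℝ}, c ≤ C₁ + C₂ + C₃ → c * a ^ s ≤ (C₁ + C₂ + C₃) * a ^ s :=
    fun h => mul_le_mul_of_nonneg_right h (by positivity)
  have hbound : ∀ i x, |b i * clamp B (g i x)| ≤ |b i| * B := fun i x => by
    rw [abs_mul]; gcongr; exact abs_clamp_le hB0.le _
  refine ⟨fun x => ∑ i, b i * clamp B (g i x), fun x => ∑ i, b i * (g i x - clamp B (g i x)),
    Finset.measurable_fun_sum _ fun i _ => (hmu i).const_mul _,
    Finset.measurable_fun_sum _ fun i _ => (hmv i).const_mul _, ?_, ?_, ?_, ?_, ?_, ?_⟩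
  · funext x
    rw [← Finset.sum_add_distrib]
    exact Finset.sum_congr rfl fun i _ => by ring
  · intro x
    calc |∑ i, b i * clamp B (g i x)| ≤ ∑ i, |b i| * B :=
          (Finset.abs_sum_le_sum_abs _ _).trans (Finset.sum_le_sum fun i _ => hbound i x)
      _ ≤ 1 * B := by rw [← Finset.sum_mul]; gcongr
      _ = B := one_mul B
  · intro κ _ hκ hκa
    have h_int : ∀ i, Integrable (fun x => b i * clamp B (g i x)) μ := fun i =>
      Integrable.of_bound ((hmu i).const_mul _).aestronglyMeasurable (|b i| * B)
        (ae_of_all _ (hbound i))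
    calc _ ≤ ∑ i, ∫ x, |centeredOp κ μ (fun x => b i * clamp B (g i x)) x| ∂μ :=
          integral_abs_centeredOp_finset_sum_le hκ _ fun i _ => h_int i
      _ ≤ ∑ i, |b i| * (4 * B * a) := by
          refine Finset.sum_le_sum fun i _ => ?_
          rw [integral_abs_centeredOp_const_mul]
          gcongr
          exact integral_abs_centeredOp_le_of_levelSets hκ hκa hB0
            ((hg i).ordConnected_levelSet_clamp hB0.le) fun x => abs_clamp_le hB0.le _
      _ ≤ 1 * (4 * B * a) := by rw [← Finset.sum_mul]; gcongr
      _ = _ := one_mul _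
  · refine eLpNorm_sum_mul_le hb hmv le_rfl fun i => (h₁ _ (hg i) a ha).trans ?_
    refine ENNReal.ofReal_le_ofReal ?_
    simp only [inv_one, ENNReal.toReal_one]
    exact hmono (by linarith)
  · refine eLpNorm_sum_mul_le hb hmv (by norm_num)
      fun i => (h₂ _ (hg i) a ha).trans ?_
    refine ENNReal.ofReal_le_ofReal ?_
    rw [show (2 : ℝ≥0∞)⁻¹.toReal = 1 / 2 by simp]
    exact hmono (by linarith)
  · refine eLpNorm_sum_mul_le hb hmv (one_le_conj p)
      fun i => (h₃ _ (hg i) a ha).trans ?_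
    refine ENNReal.ofReal_le_ofReal ?_
    rw [toReal_inv_conj hp, show 1 - p⁻¹.toReal - p⁻¹.toReal = 1 - 2 * p⁻¹.toReal by ring]
    exact hmono (by linarith)

lemma eLpNorm_le_of_abs_le_of_integral_le {F : ℝ → ℝ} (hF : AEStronglyMeasurable F μ) {D b : ℝ}
    (hD : 0 ≤ D) (hb : 0 ≤ b) (hFD : ∀ x, |F x| ≤ D) (hFb : ∫ x, |F x| ∂μ ≤ 2 * D * b)
    {r : ℝ≥0∞} (hr : 1 ≤ r) (hr' : r ≠ ∞) :
    eLpNorm F r μ ≤ ENNReal.ofReal (2 * D * b ^ r⁻¹.toReal) := by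
  have hr0 : r ≠ 0 := (zero_lt_one.trans_le hr).ne'
  have hR : 1 ≤ r.toReal := by
    rw [← ENNReal.toReal_one]; exact ENNReal.toReal_mono hr' hr
  rw [eLpNorm_eq_lintegral_rpow_enorm_toReal hr0 hr', ENNReal.toReal_inv]
  set R := r.toReal
  have h_int : Integrable F μ := Integrable.of_bound hF D (ae_of_all _ hFD)
  have h1 : ∫⁻ x, ‖F x‖ₑ ^ R ∂μ ≤ ENNReal.ofReal (D ^ (R - 1) * (2 * D * b)) := by
    calc ∫⁻ x, ‖F x‖ₑ ^ R ∂μ ≤ ∫⁻ x, ENNReal.ofReal (D ^ (R - 1)) * ENNReal.ofReal |F x| ∂μ := by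
          refine lintegral_mono fun x => ?_
          rw [← ofReal_norm, Real.norm_eq_abs,
            ENNReal.ofReal_rpow_of_nonneg (abs_nonneg _) (by linarith),
            ← ENNReal.ofReal_mul (by positivity)]
          refine ENNReal.ofReal_le_ofReal ?_
          calc |F x| ^ R = |F x| ^ ((R - 1) + 1) := by ring_nf
            _ = |F x| ^ (R - 1) * |F x| := Real.rpow_add_one' (abs_nonneg _) (by linarith)
            _ ≤ _ := by gcongr; exact hFD x
      _ = ENNReal.ofReal (D ^ (R - 1)) * ENNReal.ofReal (∫ x, |F x| ∂μ) := by
          rw [lintegral_const_mul' _ _ ENNReal.ofReal_ne_top,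
            ofReal_integral_eq_lintegral_ofReal h_int.abs (ae_of_all _ fun _ => abs_nonneg _)]
      _ ≤ _ := by
          rw [← ENNReal.ofReal_mul (by positivity)]
          gcongr
  calc (∫⁻ x, ‖F x‖ₑ ^ R ∂μ) ^ (1 / R)
      ≤ ENNReal.ofReal (D ^ (R - 1) * (2 * D * b)) ^ (1 / R) := by gcongr
    _ = ENNReal.ofReal ((D ^ (R - 1) * (2 * D * b)) ^ (1 / R)) :=
        ENNReal.ofReal_rpow_of_nonneg (by positivity) (by positivity)
    _ ≤ _ := by
        refine ENNReal.ofReal_le_ofReal ?_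
        have e : D ^ (R - 1) * (2 * D * b) = D ^ R * (2 * b) := by
          have : D ^ R = D ^ (R - 1) * D := by
            rw [← Real.rpow_add_one' hD (by linarith)]; ring_nf
          rw [this]; ring
        have h2 : (2 : ℝ) ^ (1 / R) ≤ 2 ^ (1 : ℝ) :=
          Real.rpow_le_rpow_of_exponent_le (by norm_num) (by rw [div_le_one] <;> linarith)
        rw [Real.rpow_one] at h2
        rw [e, Real.mul_rpow (by positivity) (by positivity), Real.mul_rpow (by norm_num) hb,
          ← Real.rpow_mul hD, mul_one_div_cancel (by linarith), Real.rpow_one, ← one_div]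
        have : 0 ≤ D * b ^ (1 / R) := by positivity
        nlinarith

lemma integral_abs_le_of_eLpNorm_le {F : ℝ → ℝ} (hF : AEStronglyMeasurable F μ) {D : ℝ}
    (hD : 0 ≤ D) (h : eLpNorm F 1 μ ≤ ENNReal.ofReal D) : ∫ x, |F x| ∂μ ≤ D := by
  rw [eLpNorm_one_eq_lintegral_enorm] at h
  change ∫ x, ‖F x‖ ∂μ ≤ D
  rw [integral_norm_eq_lintegral_enorm hF]
  exact ENNReal.toReal_le_of_le_ofReal hD h

lemma abs_integral_mul_le_of_abs_le {F G : ℝ → ℝ} {D : ℝ} (hF : ∀ x, |F x| ≤ D)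
    (hG : Integrable G μ) : |∫ x, F x * G x ∂μ| ≤ D * ∫ x, |G x| ∂μ := by
  rw [← integral_const_mul]
  refine (norm_integral_le_of_norm_le (f := fun x => F x * G x) (hG.abs.const_mul D) (ae_of_all _ fun x => ?_))
  rw [Real.norm_eq_abs, abs_mul]
  gcongr
  exact hF x

lemma abs_integral_mul_le_of_eLpNorm_le {α : Type*} {m : MeasurableSpace α} {ν : Measure α}
    {F G : α → ℝ} (hF : MemLp F 2 ν)
    (hG : MemLp G 2 ν) {D E : ℝ} (hD : 0 ≤ D) (hE : 0 ≤ E)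
    (hFD : eLpNorm F 2 ν ≤ ENNReal.ofReal D) (hGE : eLpNorm G 2 ν ≤ ENNReal.ofReal E) :
    |∫ x, F x * G x ∂ν| ≤ D * E := by
  have h1 : eLpNorm (fun x => F x * G x) 1 ν ≤ eLpNorm F 2 ν * eLpNorm G 2 ν := by
    have := eLpNorm_smul_le_mul_eLpNorm (r := 1) (p := 2) (q := 2) hG.1 hF.1
    exact this
  have h2 : ∫⁻ x, ‖F x * G x‖ₑ ∂ν ≤ ENNReal.ofReal (D * E) := by
    rw [← eLpNorm_one_eq_lintegral_enorm, ENNReal.ofReal_mul hD]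
    exact h1.trans (by gcongr)
  rw [← Real.norm_eq_abs, ← toReal_enorm]
  exact ENNReal.toReal_le_of_le_ofReal (by positivity)
    ((enorm_integral_le_lintegral_enorm _).trans h2)

/-- Uniform estimates for combinations of monotone functions. -/
lemma exists_bounds_of_isMonComb (hM : 0 < M) (hp : 2 < p) :
    ∃ C : ℝ, 0 ≤ C ∧
      (∀ w, IsMonComb M p μ w → Measurable w ∧ eLpNorm w 2 μ ≤ ENNReal.ofReal C) ∧
      ∀ κ : Kernel ℝ ℝ, IsMarkovKernel κ → κ.Invariant μ → ∀ a : ℝ, 0 < a →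
        (∀ t, ∫ x, |centeredOp κ μ (indic t) x| ∂μ ≤ a) →
        (∀ w, IsMonComb M p μ w → eLpNorm (centeredOp κ μ w) (1 - 1 / p)⁻¹ μ
            ≤ ENNReal.ofReal (C * a ^ (1 - 2 * p⁻¹.toReal))) ∧
        ∀ κ' : Kernel ℝ ℝ, IsMarkovKernel κ' → κ'.Invariant μ →
          ∀ w w', IsMonComb M p μ w → IsMonComb M p μ w' →
            |∫ x, centeredOp κ' μ w x * centeredOp κ μ w' x ∂μ|
              ≤ C * a ^ (1 - 2 * p⁻¹.toReal) := by
  obtain ⟨C, hC, h⟩ := exists_decomposition (μ := μ) hM hp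
  set θ := p⁻¹.toReal
  have hθ : θ < 1 / 2 := toReal_inv_lt_half hp
  have hq1 := one_le_conj p
  have hq2 : (1 - 1 / p)⁻¹ ≠ ∞ := (conj_lt_two hp).ne_top
  have hL2 : ∀ {v : ℝ → ℝ} {D : ℝ}, Measurable v → eLpNorm v 2 μ ≤ ENNReal.ofReal D →
      MemLp v 2 μ := fun hv hD => ⟨hv.aestronglyMeasurable, hD.trans_lt ENNReal.ofReal_lt_top⟩
  have hbd : ∀ {u : ℝ → ℝ} {D : ℝ}, Measurable u → (∀ x, |u x| ≤ D) → MemLp u 2 μ :=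
    fun hu hD => MemLp.of_bound hu.aestronglyMeasurable _ (ae_of_all _ hD)
  have hone : ∀ {v : ℝ → ℝ}, MemLp v 2 μ → Integrable v μ :=
    fun hv => hv.integrable (by norm_num)
  refine ⟨(M + C) + (4 * M + 2 * C) + (8 * M ^ 2 + 8 * M * C + 4 * C ^ 2), by positivity,
    fun w hw => ?_, fun κ _ hκ a ha hκa => ⟨fun w hw => ?_, fun κ' _ hκ' w w' hw hw' => ?_⟩⟩
  · obtain ⟨u, v, hu, hv, rfl, huB, -, -, hv2, -⟩ := h w hw 1 one_pos
    refine ⟨hu.add hv, ?_⟩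
    simp only [Real.one_rpow, mul_one] at huB hv2
    calc eLpNorm (fun x => u x + v x) 2 μ ≤ eLpNorm u 2 μ + eLpNorm v 2 μ :=
          eLpNorm_add_le hu.aestronglyMeasurable hv.aestronglyMeasurable (by norm_num)
      _ ≤ ENNReal.ofReal M + ENNReal.ofReal C := by
          gcongr
          simpa using eLpNorm_le_of_ae_bound (μ := μ) (p := 2) (ae_of_all μ huB)
      _ ≤ _ := by
          rw [← ENNReal.ofReal_add hM.le hC]
          refine ENNReal.ofReal_le_ofReal ?_
          have : 0 ≤ (4 * M + 2 * C) + (8 * M ^ 2 + 8 * M * C + 4 * C ^ 2) := by positivity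
          linarith
  · obtain ⟨u, v, hu, hv, rfl, huB, huκ, -, hv2, hvq⟩ := h w hw a ha
    have hB0 : 0 ≤ M * a ^ (-θ) := by positivity
    have iu := hone (hbd hu huB)
    have iv := hone (hL2 hv hv2)
    rw [eLpNorm_congr_ae (centeredOp_add hκ iu iv)]
    have e1 : eLpNorm (centeredOp κ μ u) (1 - 1 / p)⁻¹ μ
        ≤ ENNReal.ofReal (4 * M * a ^ (1 - 2 * θ)) := by
      refine (eLpNorm_le_of_abs_le_of_integral_le (aestronglyMeasurable_centeredOp hκ iu.1)
        (D := 2 * (M * a ^ (-θ))) (by positivity) ha.le (abs_centeredOp_le huB)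
        (by linarith [huκ κ ‹_› hκ hκa]) hq1 hq2).trans_eq ?_
      rw [toReal_inv_conj hp]
      congr 1
      rw [show 2 * (2 * (M * a ^ (-θ))) * a ^ (1 - θ) = 4 * M * (a ^ (-θ) * a ^ (1 - θ)) by ring,
        ← Real.rpow_add ha]
      ring_nf
    have e2 : eLpNorm (centeredOp κ μ v) (1 - 1 / p)⁻¹ μ
        ≤ ENNReal.ofReal (2 * C * a ^ (1 - 2 * θ)) := by
      refine (eLpNorm_centeredOp_le hκ hq1 hq2 hv.aestronglyMeasurable).trans ?_
      rw [mul_assoc, ENNReal.ofReal_mul (by norm_num)]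
      simpa using mul_le_mul_right hvq 2
    calc _ ≤ eLpNorm (centeredOp κ μ u) (1 - 1 / p)⁻¹ μ
          + eLpNorm (centeredOp κ μ v) (1 - 1 / p)⁻¹ μ :=
          eLpNorm_add_le (aestronglyMeasurable_centeredOp hκ iu.1)
            (aestronglyMeasurable_centeredOp hκ iv.1) hq1
      _ ≤ _ := add_le_add e1 e2
      _ ≤ _ := by
          rw [← ENNReal.ofReal_add (by positivity) (by positivity), ← add_mul]
          refine ENNReal.ofReal_le_ofReal (mul_le_mul_of_nonneg_right ?_ (by positivity))
          have : 0 ≤ (M + C) + (8 * M ^ 2 + 8 * M * C + 4 * C ^ 2) := by positivity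
          linarith
  · obtain ⟨u, v, hu, hv, rfl, huB, -, hv1, hv2, -⟩ := h w hw a ha
    obtain ⟨u', v', hu', hv', rfl, huB', huκ', hv1', hv2', -⟩ := h w' hw' a ha
    have hB0 : 0 ≤ M * a ^ (-θ) := by positivity
    have mu := hbd hu huB
    have mu' := hbd hu' huB'
    have mv := hL2 hv hv2
    have mv' := hL2 hv' hv2'
    have two_ne : (2 : ℝ≥0∞) ≠ ∞ := by norm_num
    have one_le : (1 : ℝ≥0∞) ≤ 2 := by norm_num
    have au := memLp_centeredOp hκ' one_le two_ne mu
    have av := memLp_centeredOp hκ' one_le two_ne mv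
    have au' := memLp_centeredOp hκ one_le two_ne mu'
    have av' := memLp_centeredOp hκ one_le two_ne mv'
    have split : ∫ x, centeredOp κ' μ (fun x => u x + v x) x
        * centeredOp κ μ (fun x => u' x + v' x) x ∂μ
        = ∫ x, centeredOp κ' μ u x * centeredOp κ μ u' x ∂μ
          + ∫ x, centeredOp κ' μ u x * centeredOp κ μ v' x ∂μ
          + ∫ x, centeredOp κ μ u' x * centeredOp κ' μ v x ∂μ
          + ∫ x, centeredOp κ' μ v x * centeredOp κ μ v' x ∂μ := by
      have i1 : Integrable (fun x => centeredOp κ' μ u x * centeredOp κ μ u' x) μ :=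
        au.integrable_mul au'
      have i2 : Integrable (fun x => centeredOp κ' μ u x * centeredOp κ μ v' x) μ :=
        au.integrable_mul av'
      have i3 : Integrable (fun x => centeredOp κ μ u' x * centeredOp κ' μ v x) μ :=
        au'.integrable_mul av
      have i4 : Integrable (fun x => centeredOp κ' μ v x * centeredOp κ μ v' x) μ :=
        av.integrable_mul av'
      rw [← integral_add i1 i2, ← integral_add (i1.fun_add i2) i3,
        ← integral_add ((i1.fun_add i2).fun_add i3) i4]
      refine integral_congr_ae ?_
      filter_upwards [centeredOp_add hκ' (hone mu) (hone mv),
        centeredOp_add hκ (hone mu') (hone mv')] with x h1 h2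
      rw [h1, h2]
      ring
    have pw1 : a ^ (-θ) * (a ^ (-θ) * a) = a ^ (1 - 2 * θ) := by
      nth_rw 3 [← Real.rpow_one a]
      rw [← Real.rpow_add ha, ← Real.rpow_add ha]; ring_nf
    have pw2 : a ^ (-θ) * a ^ (1 - θ) = a ^ (1 - 2 * θ) := by
      rw [← Real.rpow_add ha]; ring_nf
    have pw3 : a ^ (1 / 2 - θ) * a ^ (1 / 2 - θ) = a ^ (1 - 2 * θ) := by
      rw [← Real.rpow_add ha]; ring_nf
    have L1 : ∀ {κ : Kernel ℝ ℝ} [IsMarkovKernel κ], κ.Invariant μ → ∀ {v : ℝ → ℝ},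
        MemLp v 2 μ → eLpNorm v 1 μ ≤ ENNReal.ofReal (C * a ^ (1 - θ)) →
        ∫ x, |centeredOp κ μ v x| ∂μ ≤ 2 * (C * a ^ (1 - θ)) := fun hκ v mv hv =>
      (integral_abs_centeredOp_le hκ (hone mv)).trans (mul_le_mul_of_nonneg_left
        (integral_abs_le_of_eLpNorm_le mv.1 (by positivity) hv) (by norm_num))
    have L2 : ∀ {κ : Kernel ℝ ℝ} [IsMarkovKernel κ], κ.Invariant μ → ∀ {v : ℝ → ℝ},
        MemLp v 2 μ → eLpNorm v 2 μ ≤ ENNReal.ofReal (C * a ^ (1 / 2 - θ)) →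
        eLpNorm (centeredOp κ μ v) 2 μ ≤ ENNReal.ofReal (2 * (C * a ^ (1 / 2 - θ))) :=
      fun hκ v mv hv => (eLpNorm_centeredOp_le hκ one_le two_ne mv.1).trans (by
        rw [ENNReal.ofReal_mul (by norm_num)]
        simpa using mul_le_mul_right hv 2)
    have t1 : |∫ x, centeredOp κ' μ u x * centeredOp κ μ u' x ∂μ|
        ≤ 8 * M ^ 2 * a ^ (1 - 2 * θ) := by
      refine (abs_integral_mul_le_of_abs_le (abs_centeredOp_le huB)
        (integrable_centeredOp hκ (hone mu'))).trans ((mul_le_mul_of_nonneg_left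
          (huκ' κ ‹_› hκ hκa) (by positivity)).trans_eq ?_)
      rw [← pw1]; ring
    have t2 : |∫ x, centeredOp κ' μ u x * centeredOp κ μ v' x ∂μ|
        ≤ 4 * M * C * a ^ (1 - 2 * θ) := by
      refine (abs_integral_mul_le_of_abs_le (abs_centeredOp_le huB)
        (integrable_centeredOp hκ (hone mv'))).trans ((mul_le_mul_of_nonneg_left
          (L1 hκ mv' hv1') (by positivity)).trans_eq ?_)
      rw [← pw2]; ring
    have t3 : |∫ x, centeredOp κ μ u' x * centeredOp κ' μ v x ∂μ|
        ≤ 4 * M * C * a ^ (1 - 2 * θ) := by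
      refine (abs_integral_mul_le_of_abs_le (abs_centeredOp_le huB')
        (integrable_centeredOp hκ' (hone mv))).trans ((mul_le_mul_of_nonneg_left
          (L1 hκ' mv hv1) (by positivity)).trans_eq ?_)
      rw [← pw2]; ring
    have t4 : |∫ x, centeredOp κ' μ v x * centeredOp κ μ v' x ∂μ|
        ≤ 4 * C ^ 2 * a ^ (1 - 2 * θ) := by
      refine (abs_integral_mul_le_of_eLpNorm_le av av' (by positivity) (by positivity)
        (L2 hκ' mv hv2) (L2 hκ mv' hv2')).trans_eq ?_
      rw [← pw3]; ring
    rw [split]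
    refine (abs_add_le _ _).trans ((add_le_add ((abs_add_le _ _).trans (add_le_add
      ((abs_add_le _ _).trans (add_le_add t1 t2)) t3)) t4).trans ?_)
    rw [← add_mul, ← add_mul, ← add_mul]
    refine mul_le_mul_of_nonneg_right ?_ (by positivity)
    have : 0 ≤ (M + C) + (4 * M + 2 * C) := by positivity
    linarith

end Combination

section ClassC

set_option linter.unusedSectionVars false

variable {μ : Measure ℝ} [IsProbabilityMeasure μ] {M : ℝ} {p : ℝ≥0∞} {f : ℝ → ℝ}

lemma eLpNorm_le_of_tendsto_eLpNorm_one {α : Type*} {m : MeasurableSpace α} {ν : Measure α}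
    {w : ℕ → α → ℝ} {u : α → ℝ} (hw : ∀ j, AEStronglyMeasurable (w j) ν)
    (hu : AEStronglyMeasurable u ν)
    (hlim : Tendsto (fun j => eLpNorm (w j - u) 1 ν) atTop (𝓝 0)) {r D : ℝ≥0∞}
    (hD : ∀ j, eLpNorm (w j) r ν ≤ D) : eLpNorm u r ν ≤ D :=
  eLpNorm_le_of_tendstoInMeasure (Eventually.of_forall hD)
    (tendstoInMeasure_of_tendsto_eLpNorm one_ne_zero hw hu hlim) hw

/-- Convergence in `L¹` together with boundedness in `L²` implies weak convergence in `L²`. -/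
lemma abs_integral_mul_le_of_tendsto {φ : ℝ → ℝ} (hφ : MemLp φ 2 μ) {w : ℕ → ℝ → ℝ} {u : ℝ → ℝ}
    (hw : ∀ j, AEStronglyMeasurable (w j) μ) (hu : AEStronglyMeasurable u μ)
    (hlim : Tendsto (fun j => eLpNorm (w j - u) 1 μ) atTop (𝓝 0)) {D : ℝ} (hD : 0 ≤ D)
    (hwD : ∀ j, eLpNorm (w j) 2 μ ≤ ENNReal.ofReal D) {E : ℝ}
    (hE : ∀ j, |∫ x, φ x * w j x ∂μ| ≤ E) : |∫ x, φ x * u x ∂μ| ≤ E := by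
  have huD := eLpNorm_le_of_tendsto_eLpNorm_one hw hu hlim hwD
  have mu : MemLp u 2 μ := ⟨hu, huD.trans_lt ENNReal.ofReal_lt_top⟩
  have mw : ∀ j, MemLp (w j) 2 μ := fun j => ⟨hw j, (hwD j).trans_lt ENNReal.ofReal_lt_top⟩
  have mwu : ∀ j, MemLp (w j - u) 2 μ := fun j => (mw j).sub mu
  have hwu : ∀ j, eLpNorm (w j - u) 2 μ ≤ ENNReal.ofReal (D + D) := fun j => by
    rw [ENNReal.ofReal_add hD hD]
    exact (eLpNorm_sub_le (hw j) hu (by norm_num)).trans (add_le_add (hwD j) huD)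
  refine le_of_forall_pos_le_add fun ε hε => ?_
  obtain ⟨ψ, hψ, hψ2⟩ := hφ.exists_simpleFunc_eLpNorm_sub_lt (by norm_num)
    (ε := ENNReal.ofReal (ε / (D + D + 1))) (by simp; positivity)
  obtain ⟨B, hB⟩ := ψ.exists_forall_norm_le
  have key : ∀ j, |∫ x, φ x * u x ∂μ| ≤ E + (ε / (D + D + 1) * (D + D)
      + B * (eLpNorm (w j - u) 1 μ).toReal) := fun j => by
    have i1 : Integrable (fun x => φ x * w j x) μ := hφ.integrable_mul (mw j)
    have i2 : Integrable (fun x => (φ - ψ) x * (w j - u) x) μ :=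
      (hφ.sub hψ2).integrable_mul (mwu j)
    have i3 : Integrable (fun x => ψ x * (w j - u) x) μ := hψ2.integrable_mul (mwu j)
    have e : ∫ x, φ x * u x ∂μ = ∫ x, φ x * w j x ∂μ - (∫ x, (φ - ψ) x * (w j - u) x ∂μ
        + ∫ x, ψ x * (w j - u) x ∂μ) := by
      rw [← integral_add i2 i3, ← integral_sub i1 (i2.fun_add i3)]
      refine integral_congr_ae (ae_of_all _ fun x => ?_)
      simp only [Pi.sub_apply]
      ring
    rw [e]
    refine (abs_sub _ _).trans (add_le_add (hE j) ((abs_add_le _ _).trans (add_le_add ?_ ?_)))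
    · exact abs_integral_mul_le_of_eLpNorm_le (hφ.sub hψ2) (mwu j) (by positivity)
        (by positivity) hψ.le (hwu j)
    · refine (abs_integral_mul_le_of_abs_le hB ((mwu j).integrable (by norm_num))).trans_eq ?_
      congr 1
      rw [eLpNorm_one_eq_lintegral_enorm]
      exact integral_norm_eq_lintegral_enorm (mwu j).1
  have lim : Tendsto (fun j => E + (ε / (D + D + 1) * (D + D)
      + B * (eLpNorm (w j - u) 1 μ).toReal)) atTop
      (𝓝 (E + (ε / (D + D + 1) * (D + D) + B * 0))) := by
    have := (ENNReal.tendsto_toReal ENNReal.zero_ne_top).comp hlim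
    exact ((this.const_mul B).const_add _).const_add _
  refine (ge_of_tendsto' lim key).trans ?_
  have : ε / (D + D + 1) * (D + D) ≤ ε := by
    rw [div_mul_eq_mul_div, div_le_iff₀ (by positivity)]
    nlinarith
  linarith

lemma ClassC.exists_seq (hf : ClassC M p μ f)
    (hmeas : ∀ w, IsMonComb M p μ w → Integrable w μ) :
    ∃ w : ℕ → ℝ → ℝ, (∀ j, IsMonComb M p μ (w j)) ∧
      Tendsto (fun j => eLpNorm (w j - f) 1 μ) atTop (𝓝 0) := by
  have h : ∀ j : ℕ, ∃ w, IsMonComb M p μ w ∧ ∫ x, |f x - w x| ∂μ < 1 / ((j : ℝ) + 1) := fun j => by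
    obtain ⟨n, a, g, ha, hg, hlt⟩ := hf.2 (1 / ((j : ℝ) + 1)) (by positivity)
    exact ⟨_, ⟨n, a, g, ha, hg, rfl⟩, hlt⟩
  choose w hw hlt using h
  refine ⟨w, hw, ?_⟩
  have e : ∀ j, eLpNorm (w j - f) 1 μ = ENNReal.ofReal (∫ x, |f x - w j x| ∂μ) := fun j => by
    rw [eLpNorm_sub_comm, eLpNorm_one_eq_lintegral_enorm]
    exact (ofReal_integral_norm_eq_lintegral_enorm (hf.1.sub (hmeas _ (hw j)))).symm
  simp only [e]
  have : Tendsto (fun j => ∫ x, |f x - w j x| ∂μ) atTop (𝓝 0) :=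
    squeeze_zero (fun j => integral_nonneg fun _ => abs_nonneg _) (fun j => (hlt j).le)
      tendsto_one_div_add_atTop_nhds_zero_nat
  simpa using ENNReal.tendsto_ofReal this

/-- The estimates for combinations of monotone functions extend to their `L¹` closure. -/
lemma ClassC.exists_bounds (hM : 0 < M) (hp : 2 < p) (hf : ClassC M p μ f) :
    ∃ C : ℝ, 0 ≤ C ∧ MemLp f 2 μ ∧
      ∀ κ : Kernel ℝ ℝ, IsMarkovKernel κ → κ.Invariant μ → ∀ a : ℝ, 0 < a →
        (∀ t, ∫ x, |centeredOp κ μ (indic t) x| ∂μ ≤ a) →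
        eLpNorm (centeredOp κ μ f) (1 - 1 / p)⁻¹ μ
            ≤ ENNReal.ofReal (C * a ^ (1 - 2 * p⁻¹.toReal)) ∧
        ∀ κ' : Kernel ℝ ℝ, IsMarkovKernel κ' → κ'.Invariant μ →
            |∫ x, centeredOp κ' μ f x * centeredOp κ μ f x ∂μ|
              ≤ C * a ^ (1 - 2 * p⁻¹.toReal) := by
  obtain ⟨C, hC, hC2, h⟩ := exists_bounds_of_isMonComb (μ := μ) (p := p) hM hp
  have mem : ∀ w, IsMonComb M p μ w → MemLp w 2 μ := fun w hw =>
    ⟨(hC2 w hw).1.aestronglyMeasurable, (hC2 w hw).2.trans_lt ENNReal.ofReal_lt_top⟩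
  have one_le : (1 : ℝ≥0∞) ≤ 2 := by norm_num
  have two_ne : (2 : ℝ≥0∞) ≠ ∞ := by norm_num
  obtain ⟨w, hw, hlim⟩ := hf.exists_seq fun w hw => (mem w hw).integrable one_le
  have iw : ∀ j, Integrable (w j) μ := fun j => (mem _ (hw j)).integrable one_le
  have hf2 : MemLp f 2 μ := ⟨hf.1.1, (eLpNorm_le_of_tendsto_eLpNorm_one (fun j => (iw j).1) hf.1.1
    hlim fun j => (hC2 _ (hw j)).2).trans_lt ENNReal.ofReal_lt_top⟩
  have hA : ∀ κ : Kernel ℝ ℝ, IsMarkovKernel κ → κ.Invariant μ →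
      Tendsto (fun j => eLpNorm (centeredOp κ μ (w j) - centeredOp κ μ f) 1 μ) atTop (𝓝 0) := by
    intro κ _ hκ
    have hle : ∀ j, eLpNorm (centeredOp κ μ (w j) - centeredOp κ μ f) 1 μ
        ≤ 2 * eLpNorm (w j - f) 1 μ := fun j => by
      refine (eLpNorm_congr_ae ?_).trans_le
        (eLpNorm_centeredOp_le hκ le_rfl ENNReal.one_ne_top ((iw j).sub hf.1).1)
      exact (centeredOp_sub hκ (iw j) hf.1).symm
    refine tendsto_of_tendsto_of_tendsto_of_le_of_le tendsto_const_nhds ?_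
      (fun _ => zero_le) hle
    simpa using ENNReal.Tendsto.const_mul hlim (Or.inr (by norm_num : (2 : ℝ≥0∞) ≠ ∞))
  have hA2 : ∀ κ : Kernel ℝ ℝ, IsMarkovKernel κ → κ.Invariant μ → ∀ j,
      eLpNorm (centeredOp κ μ (w j)) 2 μ ≤ ENNReal.ofReal (2 * C) := fun κ _ hκ j => by
    refine (eLpNorm_centeredOp_le hκ one_le two_ne (iw j).1).trans ?_
    rw [ENNReal.ofReal_mul (by norm_num)]
    simpa using mul_le_mul_right (hC2 _ (hw j)).2 2
  have mA : ∀ κ : Kernel ℝ ℝ, IsMarkovKernel κ → κ.Invariant μ → ∀ {u : ℝ → ℝ}, Integrable u μ →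
      AEStronglyMeasurable (centeredOp κ μ u) μ := fun κ _ hκ u hu =>
    aestronglyMeasurable_centeredOp hκ hu.1
  refine ⟨C, hC, hf2, fun κ hκm hκ a ha hκa => ⟨?_, fun κ' hκm' hκ' => ?_⟩⟩
  · exact eLpNorm_le_of_tendsto_eLpNorm_one (fun j => mA κ hκm hκ (iw j)) (mA κ hκm hκ hf.1)
      (hA κ hκm hκ) fun j => (h κ hκm hκ a ha hκa).1 _ (hw j)
  · have h1 : ∀ j, |∫ x, centeredOp κ' μ f x * centeredOp κ μ (w j) x ∂μ|
        ≤ C * a ^ (1 - 2 * p⁻¹.toReal) := fun j => by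
      simp only [mul_comm (centeredOp κ' μ f _)]
      refine abs_integral_mul_le_of_tendsto (memLp_centeredOp hκ one_le two_ne (mem _ (hw j)))
        (fun i => mA κ' hκm' hκ' (iw i)) (mA κ' hκm' hκ' hf.1) (hA κ' hκm' hκ')
        (by positivity : 0 ≤ 2 * C) (hA2 κ' hκm' hκ') fun i => ?_
      simp only [mul_comm (centeredOp κ μ (w j) _)]
      exact (h κ hκm hκ a ha hκa).2 κ' hκm' hκ' _ _ (hw i) (hw j)
    exact abs_integral_mul_le_of_tendsto (memLp_centeredOp hκ' one_le two_ne hf2)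
      (fun i => mA κ hκm hκ (iw i)) (mA κ hκm hκ hf.1) (hA κ hκm hκ)
      (by positivity : 0 ≤ 2 * C) (hA2 κ hκm hκ) h1

variable {K : Kernel ℝ ℝ} [IsMarkovKernel K]

/-- Decay of the centred iterates of the transition operator on `ClassC`. -/
lemma ClassC.exists_bounds_alpha1 (hK : K.Invariant μ) (hM : 0 < M) (hp : 2 < p)
    (hf : ClassC M p μ f) :
    ∃ C : ℝ, 0 ≤ C ∧ MemLp f 2 μ ∧ ∀ n,
        eLpNorm (centeredOp (iterKernel K n) μ f) (1 - 1 / p)⁻¹ μ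
            ≤ ENNReal.ofReal (C * alpha1 (Kop K) μ n ^ (1 - 2 / p).toReal) ∧
        ∀ k, |∫ x, centeredOp (iterKernel K k) μ f x * centeredOp (iterKernel K n) μ f x ∂μ|
              ≤ C * alpha1 (Kop K) μ n ^ (1 - 2 / p).toReal := by
  obtain ⟨C, hC, hf2, h⟩ := hf.exists_bounds hM hp
  rw [toReal_one_sub_two_div hp]
  have hs : 0 < 1 - 2 * p⁻¹.toReal := by linarith [toReal_inv_lt_half hp]
  refine ⟨C, hC, hf2, fun n => ?_⟩
  have hlim : Tendsto (fun a : ℝ => C * a ^ (1 - 2 * p⁻¹.toReal))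
      (𝓝[>] alpha1 (Kop K) μ n) (𝓝 (C * alpha1 (Kop K) μ n ^ (1 - 2 * p⁻¹.toReal))) :=
    ((Real.continuousAt_rpow_const _ _ (Or.inr hs.le)).tendsto.const_mul C).mono_left
      nhdsWithin_le_nhds
  have hev : ∀ {a : ℝ}, a ∈ Ioi (alpha1 (Kop K) μ n) → 0 < a ∧
      ∀ t, ∫ x, |centeredOp (iterKernel K n) μ (indic t) x| ∂μ ≤ a := fun ha =>
    ⟨(alpha1_nonneg _ n).trans_lt ha, fun t =>
      (integral_abs_centeredOp_indic_le_alpha1 hK n t).trans ha.le⟩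
  refine ⟨ge_of_tendsto (ENNReal.tendsto_ofReal hlim) ?_, fun k => ge_of_tendsto hlim ?_⟩
  · filter_upwards [self_mem_nhdsWithin] with a ha
    exact (h _ inferInstance (invariant_iterKernel hK n) a (hev ha).1 (hev ha).2).1
  · filter_upwards [self_mem_nhdsWithin] with a ha
    exact (h _ inferInstance (invariant_iterKernel hK n) a (hev ha).1 (hev ha).2).2 _
      inferInstance (invariant_iterKernel hK k)

end ClassC

section JointLaw

set_option linter.unusedSectionVars false

variable {μ : Measure ℝ} [IsProbabilityMeasure μ] {K : Kernel ℝ ℝ} [IsMarkovKernel K]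

lemma measurePreserving_fst_compProd : MeasurePreserving Prod.fst (μ ⊗ₘ K) μ :=
  ⟨measurable_fst, Measure.fst_compProd μ K⟩

lemma measurePreserving_snd_compProd (hK : K.Invariant μ) :
    MeasurePreserving Prod.snd (μ ⊗ₘ K) μ :=
  ⟨measurable_snd, (Measure.snd_compProd μ K).trans hK⟩

lemma memLp_two_fst {H : ℝ → ℝ} {r : ℝ≥0∞} (hH : MemLp H r μ) :
    MemLp (fun z : ℝ × ℝ => H z.1) r (μ ⊗ₘ K) :=
  hH.comp_measurePreserving measurePreserving_fst_compProd

lemma memLp_two_snd (hK : K.Invariant μ) {H : ℝ → ℝ} {r : ℝ≥0∞} (hH : MemLp H r μ) :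
    MemLp (fun z : ℝ × ℝ => H z.2) r (μ ⊗ₘ K) :=
  hH.comp_measurePreserving (measurePreserving_snd_compProd hK)

lemma integral_fst_compProd {H : ℝ → ℝ} (hH : AEStronglyMeasurable H μ) :
    ∫ z, H z.1 ∂(μ ⊗ₘ K) = ∫ x, H x ∂μ := by
  have h := measurePreserving_fst_compProd (μ := μ) (K := K)
  rw [← integral_map h.measurable.aemeasurable (by rwa [h.map_eq]), h.map_eq]

lemma integral_snd_compProd (hK : K.Invariant μ) {H : ℝ → ℝ} (hH : AEStronglyMeasurable H μ) :
    ∫ z, H z.2 ∂(μ ⊗ₘ K) = ∫ x, H x ∂μ := by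
  have h := measurePreserving_snd_compProd (μ := μ) hK
  rw [← integral_map h.measurable.aemeasurable (by rwa [h.map_eq]), h.map_eq]

/-- The conditional variance identity. -/
lemma integral_sq_sub_Kop (hK : K.Invariant μ) {H H' : ℝ → ℝ} (hH : MemLp H 2 μ)
    (hH' : Kop K H =ᵐ[μ] H') :
    ∫ z, (H z.2 - H' z.1) ^ 2 ∂(μ ⊗ₘ K) = ∫ x, H x ^ 2 ∂μ - ∫ x, H' x ^ 2 ∂μ := by
  have mH' : MemLp H' 2 μ := (memLp_congr_ae hH').1 (memLp_Kop hK (by norm_num) (by norm_num) hH)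
  have i1 : Integrable (fun z : ℝ × ℝ => H z.2 ^ 2) (μ ⊗ₘ K) := (memLp_two_snd hK hH).integrable_sq
  have i2 : Integrable (fun z : ℝ × ℝ => H' z.1 ^ 2) (μ ⊗ₘ K) := (memLp_two_fst mH').integrable_sq
  have i3 : Integrable (fun z : ℝ × ℝ => 2 * (H' z.1 * H z.2)) (μ ⊗ₘ K) :=
    ((memLp_two_fst mH').integrable_mul (memLp_two_snd hK hH)).const_mul 2
  have cross : ∫ z, 2 * (H' z.1 * H z.2) ∂(μ ⊗ₘ K) = 2 * ∫ x, H' x ^ 2 ∂μ := by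
    rw [Measure.integral_compProd i3, ← integral_const_mul]
    refine integral_congr_ae ?_
    filter_upwards [hH'] with x hx
    simp only [integral_const_mul]
    change 2 * (H' x * Kop K H x) = _
    rw [hx]; ring
  have e : (fun z : ℝ × ℝ => (H z.2 - H' z.1) ^ 2)
      = fun z => H z.2 ^ 2 + H' z.1 ^ 2 - 2 * (H' z.1 * H z.2) := by
    funext z; ring
  rw [e, integral_sub (i1.fun_add i2) i3, integral_add i1 i2, cross,
    integral_snd_compProd hK (H := fun x => H x ^ 2) hH.integrable_sq.1,
    integral_fst_compProd (H := fun x => H' x ^ 2) mH'.integrable_sq.1]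
  ring

lemma integral_sq_eq_eLpNorm {α : Type*} {m : MeasurableSpace α} {ν : Measure α} {u : α → ℝ}
    (hu : MemLp u 2 ν) : ∫ x, u x ^ 2 ∂ν = (eLpNorm u 2 ν).toReal ^ 2 := by
  have h0 : 0 ≤ ∫ x, u x ^ 2 ∂ν := integral_nonneg fun _ => sq_nonneg _
  rw [hu.eLpNorm_eq_integral_rpow_norm (by norm_num) (by norm_num)]
  have e : (fun x => ‖u x‖ ^ (2 : ℝ≥0∞).toReal) = fun x => u x ^ 2 := by
    funext x; simp
  rw [e, ENNReal.toReal_ofReal (by positivity)]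
  simp only [ENNReal.toReal_ofNat]
  rw [← Real.rpow_natCast, ← Real.rpow_mul h0]
  simp

lemma eLpNorm_two_le_of_integral_sq_le {α : Type*} {m : MeasurableSpace α} {ν : Measure α}
    {u : α → ℝ} (hu : MemLp u 2 ν) {D : ℝ} (h : ∫ x, u x ^ 2 ∂ν ≤ D) :
    eLpNorm u 2 ν ≤ ENNReal.ofReal (√D) := by
  rw [integral_sq_eq_eLpNorm hu] at h
  exact (ENNReal.le_ofReal_iff_toReal_le hu.2.ne (Real.sqrt_nonneg _)).2 (Real.le_sqrt_of_sq_le h)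

lemma tendsto_integral_sq {α : Type*} {m : MeasurableSpace α} {ν : Measure α}
    {w : ℕ → α → ℝ} {u : α → ℝ} (hw : ∀ n, MemLp (w n) 2 ν) (hu : MemLp u 2 ν)
    (h : Tendsto (fun n => eLpNorm (w n - u) 2 ν) atTop (𝓝 0)) :
    Tendsto (fun n => ∫ x, w n x ^ 2 ∂ν) atTop (𝓝 (∫ x, u x ^ 2 ∂ν)) := by
  have h1 := ((Lp.tendsto_Lp_iff_tendsto_eLpNorm'' w hw u hu).2 h).norm
  simp only [Lp.norm_toLp] at h1
  simp only [integral_sq_eq_eLpNorm (hw _), integral_sq_eq_eLpNorm hu]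
  exact h1.pow 2

end JointLaw

section Series

variable {α : Type*} {m : MeasurableSpace α} {ν : Measure α}

/-- Completeness of `L^r`: an absolutely convergent series of functions converges. -/
lemma exists_tendsto_eLpNorm_sum {r : ℝ≥0∞} (hr : 1 ≤ r) {F : ℕ → α → ℝ} {c : ℕ → ℝ}
    (hF : ∀ n, MemLp (F n) r ν) (hc0 : ∀ n, 0 ≤ c n) (hc : Summable c)
    (hFc : ∀ n, eLpNorm (F n) r ν ≤ ENNReal.ofReal (c n)) :
    ∃ g : α → ℝ, Measurable g ∧ MemLp g r ν ∧
      Tendsto (fun n => eLpNorm ((fun x => ∑ k ∈ Finset.range n, F k x) - g) r ν) atTop (𝓝 0) := by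
  have : Fact (1 ≤ r) := ⟨hr⟩
  have hs : Summable fun n => (hF n).toLp (F n) := by
    refine Summable.of_norm_bounded hc fun n => ?_
    rw [Lp.norm_toLp]
    exact ENNReal.toReal_le_of_le_ofReal (hc0 n) (hFc n)
  refine ⟨_, (Lp.stronglyMeasurable (∑' n, (hF n).toLp (F n))).measurable, Lp.memLp _, ?_⟩
  have h := (Lp.tendsto_Lp_iff_tendsto_eLpNorm' _ _).1 hs.hasSum.tendsto_sum_nat
  refine h.congr fun n => eLpNorm_congr_ae ?_
  have h1 : (↑(∑ k ∈ Finset.range n, (hF k).toLp (F k)) : α → ℝ)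
      =ᵐ[ν] fun x => ∑ k ∈ Finset.range n, F k x := by
    induction n with
    | zero =>
      simp only [Finset.range_zero, Finset.sum_empty]
      exact Lp.coeFn_zero ℝ r ν
    | succ n ih =>
      rw [Finset.sum_range_succ]
      filter_upwards [Lp.coeFn_add (∑ k ∈ Finset.range n, (hF k).toLp (F k)) ((hF n).toLp (F n)),
        ih, (hF n).coeFn_toLp] with x h1 h2 h3
      rw [h1, Pi.add_apply, h2, h3, Finset.sum_range_succ]
  exact h1.sub EventuallyEq.rfl

end Series

section MartingaleApproximation

set_option linter.unusedSectionVars false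

lemma tendsto_mul_antitone_of_summable {c : ℕ → ℝ} (hc0 : ∀ n, 0 ≤ c n) (hc : Summable c)
    (hanti : Antitone c) : Tendsto (fun n : ℕ => (n : ℝ) * c (2 * n)) atTop (𝓝 0) := by
  have hle : ∀ n : ℕ, (n : ℝ) * c (2 * n) ≤ ∑' k, c (k + n) := fun n => by
    have h1 : ∑ k ∈ Finset.range n, c (2 * n) ≤ ∑ k ∈ Finset.range n, c (k + n) :=
      Finset.sum_le_sum fun k hk => hanti (by have := Finset.mem_range.1 hk; omega)
    rw [Finset.sum_const, Finset.card_range, nsmul_eq_mul] at h1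
    exact h1.trans (((summable_nat_add_iff n).2 hc).sum_le_tsum _ fun k _ => hc0 _)
  exact squeeze_zero (fun n => mul_nonneg n.cast_nonneg (hc0 _)) hle (tendsto_sum_nat_add c)

variable {μ : Measure ℝ} [IsProbabilityMeasure μ] {K : Kernel ℝ ℝ} [IsMarkovKernel K]
  {F : ℕ → ℝ → ℝ} {c : ℕ → ℝ}

/-- The martingale increment of the partial sums `∑_{l ≤ k < n} F k`. -/
def increment (F : ℕ → ℝ → ℝ) (s : Finset ℕ) (z : ℝ × ℝ) : ℝ :=
  ∑ k ∈ s, F k z.2 - ∑ k ∈ s, F (k + 1) z.1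

lemma memLp_increment (hK : K.Invariant μ) (hF : ∀ k, MemLp (F k) 2 μ) (s : Finset ℕ) :
    MemLp (increment F s) 2 (μ ⊗ₘ K) :=
  (memLp_two_snd (H := fun x => ∑ k ∈ s, F k x) hK (memLp_finsetSum s fun k _ => hF k)).sub
    (memLp_two_fst (H := fun x => ∑ k ∈ s, F (k + 1) x) (memLp_finsetSum s fun k _ => hF (k + 1)))

lemma integral_increment_sq (hK : K.Invariant μ) (hF : ∀ k, MemLp (F k) 2 μ)
    (hKF : ∀ k, Kop K (F k) =ᵐ[μ] F (k + 1)) {l n : ℕ} (hln : l ≤ n) :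
    ∫ z, increment F (Finset.Ico l n) z ^ 2 ∂(μ ⊗ₘ K)
      = ∑ k ∈ Finset.Ico l n, (∫ x, F l x * F k x ∂μ + ∫ x, F l x * F (k + 1) x ∂μ)
        - ∑ k ∈ Finset.Ico l n, (∫ x, F n x * F k x ∂μ + ∫ x, F n x * F (k + 1) x ∂μ) := by
  have i1 : ∀ k, Integrable (F k) μ := fun k => (hF k).integrable (by norm_num)
  have hK' : Kop K (fun x => ∑ k ∈ Finset.Ico l n, F k x)
      =ᵐ[μ] fun x => ∑ k ∈ Finset.Ico l n, F (k + 1) x := by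
    have h : ∀ᵐ x ∂μ, ∀ k, Kop K (F k) x = F (k + 1) x := ae_all_iff.2 hKF
    filter_upwards [Kop_finset_sum hK (Finset.Ico l n) fun k _ => i1 k, h] with x h1 h2
    rw [h1]
    exact Finset.sum_congr rfl fun k _ => h2 k
  have mH : MemLp (fun x => ∑ k ∈ Finset.Ico l n, F k x) 2 μ := memLp_finsetSum _ fun k _ => hF k
  have mH' : MemLp (fun x => ∑ k ∈ Finset.Ico l n, F (k + 1) x) 2 μ :=
    memLp_finsetSum _ fun k _ => hF (k + 1)
  have ii : ∀ i j, Integrable (fun x => F i x * F j x) μ := fun i j => (hF i).integrable_mul (hF j)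
  unfold increment
  rw [integral_sq_sub_Kop (H := fun x => ∑ k ∈ Finset.Ico l n, F k x)
    (H' := fun x => ∑ k ∈ Finset.Ico l n, F (k + 1) x) hK mH hK',
    ← integral_sub mH.integrable_sq mH'.integrable_sq]
  have e : ∀ x, (∑ k ∈ Finset.Ico l n, F k x) ^ 2 - (∑ k ∈ Finset.Ico l n, F (k + 1) x) ^ 2
      = ∑ k ∈ Finset.Ico l n, (F l x * F k x + F l x * F (k + 1) x)
        - ∑ k ∈ Finset.Ico l n, (F n x * F k x + F n x * F (k + 1) x) := fun x => by
    have hd : ∑ k ∈ Finset.Ico l n, F k x - ∑ k ∈ Finset.Ico l n, F (k + 1) x = F l x - F n x := by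
      have := Finset.sum_Ico_sub (fun k => F k x) hln
      rw [Finset.sum_sub_distrib] at this
      linarith
    simp only [Finset.sum_add_distrib, ← Finset.mul_sum]
    rw [sq_sub_sq, hd]
    ring
  simp only [e]
  rw [integral_sub (integrable_finsetSum _ fun k _ => (ii l k).fun_add (ii l (k + 1)))
    (integrable_finsetSum _ fun k _ => (ii n k).fun_add (ii n (k + 1))),
    integral_finsetSum _ fun k _ => (ii l k).fun_add (ii l (k + 1)),
    integral_finsetSum _ fun k _ => (ii n k).fun_add (ii n (k + 1))]
  simp only [integral_add (ii _ _) (ii _ _)]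

lemma integral_increment_sq_le (hK : K.Invariant μ) (hF : ∀ k, MemLp (F k) 2 μ)
    (hKF : ∀ k, Kop K (F k) =ᵐ[μ] F (k + 1)) (hanti : Antitone c)
    (hb : ∀ k n, |∫ x, F k x * F n x ∂μ| ≤ c n) {l n : ℕ} (hln : l ≤ n) :
    ∫ z, increment F (Finset.Ico l n) z ^ 2 ∂(μ ⊗ₘ K) ≤ 4 * ∑ k ∈ Finset.Ico l n, c k := by
  rw [integral_increment_sq hK hF hKF hln, ← Finset.sum_sub_distrib, Finset.mul_sum]
  refine Finset.sum_le_sum fun k _ => ?_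
  have h1 := (abs_le.1 (hb l k)).2
  have h2 := (abs_le.1 (hb l (k + 1))).2
  have h3 := (abs_le.1 (hb n k)).1
  have h4 := (abs_le.1 (hb n (k + 1))).1
  have h5 : c (k + 1) ≤ c k := hanti k.le_succ
  linarith

lemma tendsto_integral_increment_sq (hK : K.Invariant μ) (hF : ∀ k, MemLp (F k) 2 μ)
    (hKF : ∀ k, Kop K (F k) =ᵐ[μ] F (k + 1)) (hanti : Antitone c) (hc0 : ∀ n, 0 ≤ c n)
    (hc : Summable c) (hb : ∀ k n, |∫ x, F k x * F n x ∂μ| ≤ c n) :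
    Tendsto (fun n => ∫ z, increment F (Finset.range (2 * n)) z ^ 2 ∂(μ ⊗ₘ K)) atTop
      (𝓝 (∫ x, F 0 x ^ 2 ∂μ + 2 * ∑' k, ∫ x, F 0 x * F (k + 1) x ∂μ)) := by
  have s0 : Summable fun k => ∫ x, F 0 x * F k x ∂μ :=
    Summable.of_norm_bounded hc fun k => hb 0 k
  have s1 : Summable fun k => ∫ x, F 0 x * F (k + 1) x ∂μ := (summable_nat_add_iff 1).2 s0
  have lim1 := ((s0.add s1).hasSum.tendsto_sum_nat).comp
    (tendsto_id.const_mul_atTop' (two_pos : (0 : ℕ) < 2))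
  have lim2 : Tendsto (fun n : ℕ => ∑ k ∈ Finset.range (2 * n),
      (∫ x, F (2 * n) x * F k x ∂μ + ∫ x, F (2 * n) x * F (k + 1) x ∂μ)) atTop (𝓝 0) := by
    have hle : ∀ n : ℕ, ‖∑ k ∈ Finset.range (2 * n),
        (∫ x, F (2 * n) x * F k x ∂μ + ∫ x, F (2 * n) x * F (k + 1) x ∂μ)‖
        ≤ 4 * ((n : ℝ) * c (2 * n)) := fun n => by
      calc _ ≤ ∑ k ∈ Finset.range (2 * n), (c (2 * n) + c (2 * n)) := by
            refine norm_sum_le_of_le _ fun k _ => (abs_add_le _ _).trans (add_le_add ?_ ?_)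
            · simp only [mul_comm (F (2 * n) _)]; exact hb _ _
            · simp only [mul_comm (F (2 * n) _)]; exact hb _ _
        _ = _ := by
            rw [Finset.sum_const, Finset.card_range, nsmul_eq_mul]; push_cast; ring
    refine squeeze_zero_norm hle ?_
    simpa using (tendsto_mul_antitone_of_summable hc0 hc hanti).const_mul 4
  have h := lim1.sub lim2
  have e : ∑' k, (∫ x, F 0 x * F k x ∂μ + ∫ x, F 0 x * F (k + 1) x ∂μ) - 0
      = ∫ x, F 0 x ^ 2 ∂μ + 2 * ∑' k, ∫ x, F 0 x * F (k + 1) x ∂μ := by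
    rw [s0.tsum_add s1, s0.tsum_eq_zero_add]
    simp only [sq]
    ring
  rw [e] at h
  refine h.congr fun n => ?_
  rw [Finset.range_eq_Ico, integral_increment_sq hK hF hKF (Nat.zero_le (2 * n)),
    ← Finset.range_eq_Ico]
  rfl

/-- Gordin's decomposition under summability of the covariances. -/
theorem exists_martingale_coboundary (hK : K.Invariant μ) (hF : ∀ k, MemLp (F k) 2 μ)
    (hKF : ∀ k, Kop K (F k) =ᵐ[μ] F (k + 1)) (hanti : Antitone c) (hc0 : ∀ n, 0 ≤ c n)
    (hc : Summable c) (hb : ∀ k n, |∫ x, F k x * F n x ∂μ| ≤ c n) {r : ℝ≥0∞} (hr : 1 ≤ r)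
    (hr2 : r ≤ 2) (hFr : ∀ n, eLpNorm (F n) r μ ≤ ENNReal.ofReal (c n)) :
    ∃ g : ℝ → ℝ, Measurable g ∧ MemLp g r μ ∧
      Kop K (fun x => F 0 x + g x) =ᵐ[μ] g ∧
      ∫ z, (F 0 z.2 + g z.2 - g z.1) ^ 2 ∂(μ ⊗ₘ K)
        = ∫ x, F 0 x ^ 2 ∂μ + 2 * ∑' k, ∫ x, F 0 x * F (k + 1) x ∂μ := by
  obtain ⟨g, hgm, hgr, hg⟩ := exists_tendsto_eLpNorm_sum hr
    (F := fun k => F (k + 1)) (c := fun k => c (k + 1))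
    (fun k => (hF (k + 1)).mono_exponent hr2) (fun n => hc0 _) ((summable_nat_add_iff 1).2 hc)
    fun n => hFr _
  have i1 : ∀ k, Integrable (F k) μ := fun k => (hF k).integrable (by norm_num)
  have ig : Integrable g μ := hgr.integrable hr
  set S : ℕ → ℝ → ℝ := fun n x => ∑ k ∈ Finset.range n, F (k + 1) x with hS
  set T : ℕ → ℝ → ℝ := fun n x => ∑ k ∈ Finset.range n, F k x with hT
  set h : ℝ → ℝ := fun x => F 0 x + g x with hh
  have ih : Integrable h μ := (i1 0).add ig
  have iS : ∀ n, Integrable (S n) μ := fun n => integrable_finsetSum _ fun k _ => i1 (k + 1)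
  have iT : ∀ n, Integrable (T n) μ := fun n => integrable_finsetSum _ fun k _ => i1 k
  have limS : Tendsto (fun n => eLpNorm (S n - g) 1 μ) atTop (𝓝 0) :=
    tendsto_of_tendsto_of_tendsto_of_le_of_le tendsto_const_nhds hg (fun _ => zero_le)
      fun n => eLpNorm_le_eLpNorm_of_exponent_le hr ((iS n).sub ig).1
  have limT : Tendsto (fun n => eLpNorm (T n - h) 1 μ) atTop (𝓝 0) := by
    rw [← tendsto_add_atTop_iff_nat 1]
    refine limS.congr fun n => congrArg (fun u => eLpNorm u 1 μ) ?_
    funext x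
    simp only [Pi.sub_apply, hS, hT, hh]
    rw [Finset.sum_range_succ']
    ring
  have KT : ∀ n, Kop K (T n) =ᵐ[μ] S n := fun n => by
    have h : ∀ᵐ x ∂μ, ∀ k, Kop K (F k) x = F (k + 1) x := ae_all_iff.2 hKF
    filter_upwards [Kop_finset_sum hK (Finset.range n) fun k _ => i1 k, h] with x h1 h2
    rw [h1]
    exact Finset.sum_congr rfl fun k _ => h2 k
  have hKg : Kop K h =ᵐ[μ] g := by
    have hle : ∀ n, eLpNorm (Kop K h - g) 1 μ
        ≤ eLpNorm (T n - h) 1 μ + eLpNorm (S n - g) 1 μ := fun n => by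
      have e1 : Kop K h - g =ᵐ[μ] (fun x => (S n - g) x - Kop K (fun x => T n x - h x) x) := by
        have := Kop_add hK (iT n) (ih.const_mul (-1))
        rw [Kop_const_mul] at this
        have e2 : (fun x => T n x + -1 * h x) = fun x => T n x - h x := by funext x; ring
        rw [e2] at this
        filter_upwards [this, KT n] with x h1 h2
        simp only [Pi.sub_apply]
        rw [h1, h2]; ring
      rw [eLpNorm_congr_ae e1, add_comm]
      refine (eLpNorm_sub_le ((iS n).sub ig).1 (integrable_Kop hK ((iT n).sub ih)).1
        le_rfl).trans ?_
      gcongr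
      exact eLpNorm_Kop_le hK le_rfl ENNReal.one_ne_top ((iT n).sub ih).1
    have h0 : eLpNorm (Kop K h - g) 1 μ ≤ 0 := ge_of_tendsto' (by simpa using limT.add limS) hle
    have h1 := (eLpNorm_eq_zero_iff ((integrable_Kop hK ih).sub ig).1 one_ne_zero).1
      (le_antisymm h0 zero_le)
    filter_upwards [h1] with x hx
    simpa [sub_eq_zero] using hx
  refine ⟨g, hgm, hgr, hKg, ?_⟩
  set d : ℝ × ℝ → ℝ := fun z => h z.2 - g z.1 with hd
  have id : Integrable d (μ ⊗ₘ K) :=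
    ((memLp_two_snd hK (memLp_one_iff_integrable.2 ih)).sub
      (memLp_two_fst (memLp_one_iff_integrable.2 ig))).integrable le_rfl
  have minc : ∀ s, MemLp (increment F s) 2 (μ ⊗ₘ K) := fun s => memLp_increment hK hF s
  have limd : Tendsto (fun n => eLpNorm (increment F (Finset.range n) - d) 1 (μ ⊗ₘ K))
      atTop (𝓝 0) := by
    have hle : ∀ n, eLpNorm (increment F (Finset.range n) - d) 1 (μ ⊗ₘ K)
        ≤ eLpNorm (T n - h) 1 μ + eLpNorm (S n - g) 1 μ := fun n => by
      have e : increment F (Finset.range n) - d = (T n - h) ∘ Prod.snd - (S n - g) ∘ Prod.fst := by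
        funext z
        simp only [increment, hd, Pi.sub_apply, Function.comp, hT, hS]
        ring
      have p1 := measurePreserving_fst_compProd (μ := μ) (K := K)
      have p2 := measurePreserving_snd_compProd (μ := μ) hK
      have a1 := ((iT n).sub ih).1
      have a2 := ((iS n).sub ig).1
      rw [e, ← eLpNorm_comp_measurePreserving a1 p2, ← eLpNorm_comp_measurePreserving a2 p1]
      exact eLpNorm_sub_le (a1.comp_measurePreserving p2) (a2.comp_measurePreserving p1) le_rfl
    exact tendsto_of_tendsto_of_tendsto_of_le_of_le tendsto_const_nhds
      (by simpa using limT.add limS) (fun _ => zero_le) hle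
  have tail : ∀ l, eLpNorm (d - increment F (Finset.range l)) 2 (μ ⊗ₘ K)
      ≤ ENNReal.ofReal (√(4 * ∑' k, c (k + l))) := fun l => by
    have e : ∀ n, increment F (Finset.range (n + l)) - increment F (Finset.range l)
        = increment F (Finset.Ico l (n + l)) := fun n => by
      funext z
      simp only [increment, Pi.sub_apply, Finset.sum_Ico_eq_sub _ (Nat.le_add_left l n)]
      ring
    refine eLpNorm_le_of_tendsto_eLpNorm_one
      (w := fun n => increment F (Finset.range (n + l)) - increment F (Finset.range l))
      (fun n => ((minc _).sub (minc _)).1) (id.1.sub (minc _).1) ?_ fun n => ?_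
    · simpa only [sub_sub_sub_cancel_right] using (tendsto_add_atTop_iff_nat l).2 limd
    · rw [e]
      refine eLpNorm_two_le_of_integral_sq_le (minc _)
        ((integral_increment_sq_le hK hF hKF hanti hb (Nat.le_add_left l n)).trans ?_)
      rw [Finset.sum_Ico_eq_sum_range, Nat.add_sub_cancel]
      simp only [add_comm l]
      exact mul_le_mul_of_nonneg_left
        (((summable_nat_add_iff l).2 hc).sum_le_tsum _ fun k _ => hc0 _) (by norm_num)
  have md : MemLp d 2 (μ ⊗ₘ K) := by
    have : d = (d - increment F (Finset.range 0)) + increment F (Finset.range 0) := by simp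
    rw [this]
    exact MemLp.add ⟨id.1.sub (minc _).1, (tail 0).trans_lt ENNReal.ofReal_lt_top⟩ (minc _)
  have lim2 : Tendsto (fun n => eLpNorm (increment F (Finset.range n) - d) 2 (μ ⊗ₘ K))
      atTop (𝓝 0) := by
    refine tendsto_of_tendsto_of_tendsto_of_le_of_le tendsto_const_nhds ?_ (fun _ => zero_le)
      fun n => (eLpNorm_sub_comm _ _ _ _).trans_le (tail n)
    have := ENNReal.tendsto_ofReal ((tendsto_sum_nat_add c).const_mul 4).sqrt
    simpa using this
  exact tendsto_nhds_unique ((tendsto_integral_sq (fun n => minc _) md lim2).comp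
    (tendsto_id.const_mul_atTop' (two_pos : (0 : ℕ) < 2)))
    (tendsto_integral_increment_sq hK hF hKF hanti hc0 hc hb)

end MartingaleApproximation

section MarkovChain

variable {Ω : Type*} {m mΩ : MeasurableSpace Ω} {P : Measure Ω} [IsProbabilityMeasure P]
  {μ : Measure ℝ} [IsProbabilityMeasure μ] {K : Kernel ℝ ℝ} [IsMarkovKernel K]

/-- The joint law of a pair whose conditional law is given by a kernel. -/
lemma map_prodMk_eq_compProd {Y Z : Ω → ℝ} (hY : Measurable Y) (hZ : Measurable Z)
    (hYm : Measurable[m] Y) (hm : m ≤ mΩ)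
    (hY0 : Measure.map Y P = μ)
    (hcond : ∀ B : Set ℝ, MeasurableSet B →
      P[fun ω => B.indicator (fun _ => (1 : ℝ)) (Z ω) | m] =ᵐ[P]
        fun ω => Kop K (B.indicator fun _ => 1) (Y ω)) :
    P.map (fun ω => (Y ω, Z ω)) = μ ⊗ₘ K := by
  have hYZ : Measurable fun ω => (Y ω, Z ω) := hY.prodMk hZ
  have : IsProbabilityMeasure (P.map fun ω => (Y ω, Z ω)) :=
    Measure.isProbabilityMeasure_map hYZ.aemeasurable
  refine Measure.ext_prod fun {A B} hA hB => ?_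
  rw [← measureReal_eq_measureReal_iff]
  have hA' : MeasurableSet[m] (Y ⁻¹' A) := hYm hA
  have hk : ∀ x, Kop K (B.indicator fun _ => 1) x = (K x).real B := fun x => by
    rw [Kop, integral_indicator_const _ hB]; simp
  have h_int : Integrable (fun ω => B.indicator (fun _ => (1 : ℝ)) (Z ω)) P :=
    ((integrable_const (1 : ℝ)).indicator (hZ hB))
  have h1 := setIntegral_condExp hm h_int hA'
  rw [setIntegral_congr_ae (hm _ hA') ((hcond B hB).mono fun ω h _ => h)] at h1
  have hmk : Measurable (Kop K (B.indicator fun _ => 1)) :=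
    measurable_Kop K (measurable_const.indicator hB)
  have h2 : ∫ ω in Y ⁻¹' A, Kop K (B.indicator fun _ => 1) (Y ω) ∂P
      = ∫ x in A, Kop K (B.indicator fun _ => 1) x ∂μ := by
    rw [← hY0, setIntegral_map hA hmk.aestronglyMeasurable hY.aemeasurable]
  have h3 : ∫ ω in Y ⁻¹' A, B.indicator (fun _ => (1 : ℝ)) (Z ω) ∂P
      = P.real (Y ⁻¹' A ∩ Z ⁻¹' B) := by
    have e : (fun ω => B.indicator (fun _ => (1 : ℝ)) (Z ω))
        = (Z ⁻¹' B).indicator fun _ => 1 := rfl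
    rw [e, setIntegral_indicator (hZ hB)]
    simp
  have h4 : (μ ⊗ₘ K).real (A ×ˢ B) = ∫ x in A, Kop K (B.indicator fun _ => 1) x ∂μ := by
    simp only [hk]
    rw [measureReal_def, Measure.compProd_apply_prod hA hB, ← integral_toReal]
    · rfl
    · exact (Kernel.measurable_coe K hB).aemeasurable
    · exact ae_of_all _ fun x => measure_lt_top _ _
  rw [h4, ← h2, h1, h3, measureReal_def, Measure.map_apply hYZ (hA.prod hB)]
  rfl

/-- A function of the pair with vanishing kernel integral is a martingale increment. -/
lemma condExp_sub_eq_zero {Y Z : Ω → ℝ} (hY : Measurable Y) (hK : K.Invariant μ)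
    (hpair : MeasurePreserving (fun ω => (Y ω, Z ω)) P (μ ⊗ₘ K)) {h g : ℝ → ℝ}
    (hh : Integrable h μ) (hg : Integrable g μ) (hKg : Kop K h =ᵐ[μ] g) :
    P[fun ω => h (Z ω) - g (Y ω) | MeasurableSpace.comap Y inferInstance] =ᵐ[P] fun _ => 0 := by
  have i1 : Integrable (fun z : ℝ × ℝ => h z.2) (μ ⊗ₘ K) :=
    (measurePreserving_snd_compProd hK).integrable_comp_of_integrable hh
  have i2 : Integrable (fun z : ℝ × ℝ => g z.1) (μ ⊗ₘ K) :=
    measurePreserving_fst_compProd.integrable_comp_of_integrable hg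
  have i3 : Integrable (fun z : ℝ × ℝ => h z.2 - g z.1) (μ ⊗ₘ K) := i1.sub i2
  refine (ae_eq_condExp_of_forall_setIntegral_eq hY.comap_le
    (hpair.integrable_comp_of_integrable i3) (fun _ _ _ => integrableOn_zero) ?_
    aestronglyMeasurable_const).symm
  rintro _ ⟨A, hA, rfl⟩ -
  have e1 : ∫ ω in Y ⁻¹' A, (h (Z ω) - g (Y ω)) ∂P
      = ∫ z in A ×ˢ univ, (h z.2 - g z.1) ∂(μ ⊗ₘ K) := by
    have i4 := i3.1
    rw [← hpair.map_eq] at i4 ⊢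
    rw [setIntegral_map (hA.prod MeasurableSet.univ) i4 hpair.measurable.aemeasurable]
    congr 2
    ext ω
    simp
  change _ = ∫ ω in Y ⁻¹' A, (h (Z ω) - g (Y ω)) ∂P
  rw [e1, Measure.setIntegral_compProd hA MeasurableSet.univ i3.integrableOn]
  simp only [integral_zero, Measure.restrict_univ]
  symm
  refine integral_eq_zero_of_ae (ae_restrict_of_ae ?_)
  filter_upwards [hKg, ae_integrable_of_invariant hK hh] with x hx hxi
  rw [integral_sub hxi (integrable_const _)]
  change Kop K h x - _ = 0
  simp [hx]

end MarkovChain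

/-- The martingale–coboundary decomposition at the level of the transition kernel. -/
theorem ClassC.exists_martingale_coboundary {μ : Measure ℝ} [IsProbabilityMeasure μ]
    {K : Kernel ℝ ℝ} [IsMarkovKernel K] (hK : K.Invariant μ) {M : ℝ} (hM : 0 < M) {p : ℝ≥0∞}
    (hp : 2 < p) {f : ℝ → ℝ} (hf : ClassC M p μ f)
    (hsum : Summable fun k : ℕ =>
      (alpha1 (Kop K) μ (k + 1)) ^ (((1:ℝ≥0∞) - 2 / p).toReal)) :
    ∃ g : ℝ → ℝ, Measurable g ∧ MemLp g (1 - 1 / p)⁻¹ μ ∧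
      Kop K (fun x => f x - ∫ y, f y ∂μ + g x) =ᵐ[μ] g ∧
      ∫ z, (f z.2 - ∫ y, f y ∂μ + g z.2 - g z.1) ^ 2 ∂(μ ⊗ₘ K)
        = (∫ x, (f x - ∫ y, f y ∂μ) ^ 2 ∂μ) +
            2 * ∑' k : ℕ, ∫ x, (f x - ∫ y, f y ∂μ) * (Kop K)^[k + 1] f x ∂μ := by
  obtain ⟨C, hC, hf2, hbd⟩ := hf.exists_bounds_alpha1 hK hM hp
  have hfi : Integrable f μ := hf.1
  have hF2 : ∀ k, MemLp (centeredOp (iterKernel K k) μ f) 2 μ := fun k =>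
    memLp_centeredOp (invariant_iterKernel hK k) (by norm_num) (by norm_num) hf2
  have hF0 := centeredOp_iterKernel_zero hK hfi
  obtain ⟨g, hgm, hgr, hKg, hg2⟩ := _root_.exists_martingale_coboundary hK
    (F := fun k => centeredOp (iterKernel K k) μ f) hF2
    (fun k => Kop_centeredOp_iterKernel hK k hfi)
    (c := fun n => C * alpha1 (Kop K) μ n ^ ((1 : ℝ≥0∞) - 2 / p).toReal)
    (fun a b hab => mul_le_mul_of_nonneg_left
      (Real.rpow_le_rpow (alpha1_nonneg _ _) (antitone_alpha1 hK hab) ENNReal.toReal_nonneg) hC)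
    (fun n => mul_nonneg hC (Real.rpow_nonneg (alpha1_nonneg _ _) _))
    (((summable_nat_add_iff
      (f := fun n => alpha1 (Kop K) μ n ^ ((1 : ℝ≥0∞) - 2 / p).toReal) 1).1 hsum).mul_left C)
    (fun k n => (hbd n).2 k) (one_le_conj p) (conj_lt_two hp).le fun n => (hbd n).1
  refine ⟨g, hgm, hgr, ?_, ?_⟩
  · refine (Kop_congr_ae hK ?_).trans hKg
    filter_upwards [hF0] with x hx
    rw [hx]
  have e1 : ∫ z, (f z.2 - ∫ y, f y ∂μ + g z.2 - g z.1) ^ 2 ∂(μ ⊗ₘ K)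
      = ∫ z, (centeredOp (iterKernel K 0) μ f z.2 + g z.2 - g z.1) ^ 2 ∂(μ ⊗ₘ K) := by
    refine integral_congr_ae ?_
    filter_upwards [(measurePreserving_snd_compProd hK).quasiMeasurePreserving.ae hF0] with z hz
    rw [hz]
  have e2 : ∫ x, centeredOp (iterKernel K 0) μ f x ^ 2 ∂μ
      = ∫ x, (f x - ∫ y, f y ∂μ) ^ 2 ∂μ := by
    refine integral_congr_ae ?_
    filter_upwards [hF0] with x hx
    rw [hx]
  rw [e1, hg2, e2]
  congr 3
  funext k
  have hIter := iterate_Kop_ae_eq hK (k + 1) hfi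
  have mIter : MemLp ((Kop K)^[k + 1] f) 2 μ := (memLp_congr_ae hIter).2
    (memLp_Kop (invariant_iterKernel hK _) (by norm_num) (by norm_num) hf2)
  have mf : MemLp (fun x => f x - ∫ y, f y ∂μ) 2 μ := (memLp_congr_ae hF0).1 (hF2 0)
  have i1 : Integrable (fun x => (f x - ∫ y, f y ∂μ) * (Kop K)^[k + 1] f x) μ :=
    mf.integrable_mul mIter
  have i2 : Integrable (fun x => (f x - ∫ y, f y ∂μ) * ∫ y, f y ∂μ) μ :=
    (mf.integrable (by norm_num)).mul_const _
  have e3 : ∫ x, centeredOp (iterKernel K 0) μ f x * centeredOp (iterKernel K (k + 1)) μ f x ∂μ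
      = ∫ x, ((f x - ∫ y, f y ∂μ) * (Kop K)^[k + 1] f x
        - (f x - ∫ y, f y ∂μ) * ∫ y, f y ∂μ) ∂μ := by
    refine integral_congr_ae ?_
    filter_upwards [hF0, hIter] with x h1 h2
    rw [h1, h2, ← mul_sub]
    rfl
  rw [e3, integral_sub i1 i2, integral_mul_const, integral_sub hfi (integrable_const _)]
  simp

/-- Theorem 3(3), martingale–coboundary decomposition: under
the assumptions of Statement 5, `f(X_1) − μ(f) = m(X_1,X_0) + g(X_0) − g(X_1)`
with `μ(|g|^{p/(p−1)}) < ∞`, `E(m(X_1,X_0)|X_0) = 0` and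
`E(m²(X_1,X_0)) = σ²(μ,K,f)`.  For `p = ∞`, `p/(p−1)` is read as `1`, which is
how `((1 − 1/p)⁻¹).toReal` behaves. -/
theorem statement7 {Ω : Type*} [MeasurableSpace Ω] (P : Measure Ω)
    [IsProbabilityMeasure P] (X : ℕ → Ω → ℝ) (hXm : ∀ i, Measurable (X i))
    (μ : Measure ℝ) [IsProbabilityMeasure μ]
    (K : Kernel ℝ ℝ) [IsMarkovKernel K] (hinv : μ.bind (fun x => K x) = μ)
    (hX0 : Measure.map (X 0) P = μ)
    (hMarkov : ∀ n : ℕ, ∀ g : ℝ → ℝ, Measurable g → (∃ C, ∀ x, |g x| ≤ C) →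
      P[fun ω => g (X (n + 1) ω)
          | MeasurableSpace.comap (fun ω => fun i : Fin (n + 1) => X i.1 ω) inferInstance]
        =ᵐ[P] fun ω => Kop K g (X n ω))
    (hstat : ∀ k n : ℕ,
      Measure.map (fun ω => fun i : Fin n => X (i.1 + k) ω) P
        = Measure.map (fun ω => fun i : Fin n => X i.1 ω) P)
    (hErg : Ergodic (fun x : ℕ → ℝ => fun i => x (i + 1))
      (Measure.map (fun ω => fun i => X i ω) P))
    (M : ℝ) (hM : 0 < M) (p : ℝ≥0∞) (hp : 2 < p)
    (f : ℝ → ℝ) (hf : ClassC M p μ f)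
    (hsum : Summable fun k : ℕ =>
      (alpha1 (Kop K) μ (k + 1)) ^ (((1:ℝ≥0∞) - 2 / p).toReal)) :
    ∃ g : ℝ → ℝ, ∃ m : ℝ × ℝ → ℝ, Measurable g ∧ Measurable m ∧
      Integrable (fun x => |g x| ^ ((((1:ℝ≥0∞) - 1 / p)⁻¹).toReal)) μ ∧
      (∀ᵐ ω ∂P, f (X 1 ω) - ∫ y, f y ∂μ
          = m (X 1 ω, X 0 ω) + g (X 0 ω) - g (X 1 ω)) ∧
      (P[fun ω => m (X 1 ω, X 0 ω)
          | MeasurableSpace.comap (X 0) inferInstance] =ᵐ[P] fun _ => 0) ∧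
      ∫ ω, (m (X 1 ω, X 0 ω)) ^ 2 ∂P
        = (∫ x, (f x - ∫ y, f y ∂μ) ^ 2 ∂μ) +
            2 * ∑' k : ℕ, ∫ x, (f x - ∫ y, f y ∂μ) * (Kop K)^[k + 1] f x ∂μ := by
  have hK : K.Invariant μ := hinv
  obtain ⟨g, hgm, hgr, hKg, hg2⟩ := hf.exists_martingale_coboundary hK hM hp hsum
  have hfi : Integrable f μ := hf.1
  have hr : (1 : ℝ≥0∞) ≤ (1 - 1 / p)⁻¹ := one_le_conj p
  have hgi : Integrable g μ := hgr.integrable hr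
  have hlaw : P.map (fun ω => (X 0 ω, X 1 ω)) = μ ⊗ₘ K := by
    refine map_prodMk_eq_compProd (hXm 0) (hXm 1)
      (m := MeasurableSpace.comap (fun ω => fun i : Fin (0 + 1) => X i.1 ω) inferInstance)
      ?_ ?_ hX0 fun B hB => hMarkov 0 _ (measurable_const.indicator hB) ⟨1, fun x => ?_⟩
    · exact (@measurable_pi_iff _ _ _ (_) _ _).1
        (comap_measurable (m := MeasurableSpace.pi) fun ω => fun i : Fin (0 + 1) => X i.1 ω) 0
    · exact (measurable_pi_lambda _ fun i => hXm _).comap_le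
    · by_cases h : x ∈ B <;> simp [h]
  have hpair : MeasurePreserving (fun ω => (X 0 ω, X 1 ω)) P (μ ⊗ₘ K) :=
    ⟨(hXm 0).prodMk (hXm 1), hlaw⟩
  have hX1 : MeasurePreserving (X 1) P μ := (measurePreserving_snd_compProd hK).comp hpair
  have hff : ∀ᵐ ω ∂P, f (X 1 ω) = hfi.1.mk f (X 1 ω) :=
    hX1.quasiMeasurePreserving.ae hfi.1.ae_eq_mk
  have hfm : Measurable (hfi.1.mk f) := hfi.1.stronglyMeasurable_mk.measurable
  have hhi : Integrable (fun x => f x - ∫ y, f y ∂μ + g x) μ :=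
    (hfi.sub (integrable_const _)).add hgi
  refine ⟨g, fun z => hfi.1.mk f z.1 - ∫ y, f y ∂μ + g z.1 - g z.2, hgm, by fun_prop,
    hgr.integrable_norm_rpow (zero_lt_one.trans_le hr).ne' (conj_lt_two hp).ne_top, ?_, ?_, ?_⟩
  · filter_upwards [hff] with ω hω
    rw [hω]
    ring
  · refine (condExp_congr_ae ?_).trans (condExp_sub_eq_zero (hXm 0) hK hpair hhi hgi hKg)
    filter_upwards [hff] with ω hω
    rw [hω]
  · rw [← hg2]
    have i1 : AEStronglyMeasurable
        (fun z : ℝ × ℝ => f z.2 - ∫ y, f y ∂μ + g z.2 - g z.1) (μ ⊗ₘ K) :=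
      (((measurePreserving_snd_compProd hK).integrable_comp_of_integrable hhi).sub
        (measurePreserving_fst_compProd.integrable_comp_of_integrable hgi)).1
    have e1 := integral_map hpair.measurable.aemeasurable
      (f := fun z : ℝ × ℝ => (f z.2 - ∫ y, f y ∂μ + g z.2 - g z.1) ^ 2)
      (by rw [hlaw]; exact i1.pow 2)
    rw [hlaw] at e1
    rw [e1]
    refine integral_congr_ae ?_
    filter_upwards [hff] with ω hω
    rw [hω]

end
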